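/- arXiv:1110.5117 — 4 statements merged into one kernel-verified Lean document; each statement's English description precedes it below -/
import Mathlib

section
/- A bounded complex of finitely generated projective modules over a commutative ring A that has Tor-amplitude concentrated in [0,0] is quasi-isomorphic to a finitely generated projective module placed in degree 0. -/
open CategoryTheory Limits MonoidalCategory HomologicalComplex

section Defs

variable (R : Type) [CommRing R]

/-- Degreewise tensor of a cochain complex with a module. -/
noncomputable def tensorComplex (F : CochainComplex (ModuleCat.{0} R) ℤ) (K : ModuleCat.{0} R) :
    CochainComplex (ModuleCat.{0} R) ℤ :=
  ((tensorRight K).mapHomologicalComplex _).obj F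

/-- The complex vanishes in all sufficiently large degrees. -/
def IsBoundedAbove (F : CochainComplex (ModuleCat.{0} R) ℤ) : Prop :=
  ∃ N : ℤ, ∀ i > N, IsZero (F.X i)

/-- The complex vanishes outside a bounded range of degrees. -/
def IsBoundedC (F : CochainComplex (ModuleCat.{0} R) ℤ) : Prop :=
  ∃ m N : ℤ, ∀ i : ℤ, (i < m ∨ N < i) → IsZero (F.X i)

def DegreewiseFGFree (F : CochainComplex (ModuleCat.{0} R) ℤ) : Prop :=
  ∀ i : ℤ, Module.Finite R (F.X i) ∧ Module.Free R (F.X i)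

def DegreewiseFGProj (F : CochainComplex (ModuleCat.{0} R) ℤ) : Prop :=
  ∀ i : ℤ, Module.Finite R (F.X i) ∧ Module.Projective R (F.X i)

/-- A strictly perfect complex: bounded and degreewise finitely generated projective. -/
def IsPerfectData (F : CochainComplex (ModuleCat.{0} R) ℤ) : Prop :=
  IsBoundedC R F ∧ DegreewiseFGProj R F

/-- Tor-amplitude in `[a,b]` for a complex of projective (hence flat) modules, where the
underived degreewise tensor computes the derived tensor: for every module `K`, the homology
of `F ⊗ K` is concentrated in degrees `[a,b]`. -/
def TorAmpPlain (F : CochainComplex (ModuleCat.{0} R) ℤ) (a b : ℤ) : Prop :=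
  ∀ (K : ModuleCat.{0} R) (i : ℤ), (i < a ∨ b < i) → IsZero ((tensorComplex R F K).homology i)

/-- Tor-amplitude in `[a,b]` for an arbitrary complex, tested on every bounded-above
degreewise-projective resolution (such a resolution computes the derived tensor product). -/
def TorAmp (F : CochainComplex (ModuleCat.{0} R) ℤ) (a b : ℤ) : Prop :=
  ∀ (P : CochainComplex (ModuleCat.{0} R) ℤ) (f : P ⟶ F),
    IsBoundedAbove R P → (∀ i : ℤ, Module.Projective R (P.X i)) → QuasiIso f →
      TorAmpPlain R P a b

/-- A complex is pseudo-coherent if it admits a quasi-isomorphism from a bounded-above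
complex of finitely generated free modules. -/
def PseudoCoherent (F : CochainComplex (ModuleCat.{0} R) ℤ) : Prop :=
  ∃ (P : CochainComplex (ModuleCat.{0} R) ℤ) (f : P ⟶ F),
    IsBoundedAbove R P ∧ DegreewiseFGFree R P ∧ QuasiIso f

/-- A complex is `n`-pseudo-coherent if it admits a map from a bounded complex of finitely
generated free modules which is an isomorphism on cohomology in degrees `> n` and a
surjection in degree `n`. -/
def NPseudoCoherent (n : ℤ) (F : CochainComplex (ModuleCat.{0} R) ℤ) : Prop :=
  ∃ (P : CochainComplex (ModuleCat.{0} R) ℤ) (f : P ⟶ F),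
    IsBoundedC R P ∧ DegreewiseFGFree R P ∧
      (∀ i > n, IsIso (homologyMap f i)) ∧ Epi (homologyMap f n)

end Defs


/-- If `d'` has a generalized inverse `h'` and `d`, `d'` are exact at a projective module, then
`1 - h' d'` lifts through `d`. -/
lemma exists_comp_eq_id_sub_of_exact {R M₁ M₂ M₃ : Type*} [CommRing R]
    [AddCommGroup M₁] [AddCommGroup M₂] [AddCommGroup M₃] [Module R M₁] [Module R M₂] [Module R M₃]
    [Module.Projective R M₂] {d : M₁ →ₗ[R] M₂} {d' : M₂ →ₗ[R] M₃} (hd : Function.Exact d d')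
    {h' : M₃ →ₗ[R] M₂} (hh' : ∀ x, d' (h' (d' x)) = d' x) :
    ∃ h : M₂ →ₗ[R] M₁, ∀ x, d (h x) = x - h' (d' x) := by
  let e : M₂ →ₗ[R] M₂ := LinearMap.id - h' ∘ₗ d'
  have hmem : ∀ x, e x ∈ LinearMap.range d := fun x ↦ (hd _).1 (by simp [e, hh'])
  obtain ⟨h, hh⟩ := Module.projective_lifting_property d.rangeRestrict (e.codRestrict _ hmem)
    d.surjective_rangeRestrict
  exact ⟨h, fun x ↦ congrArg Subtype.val (LinearMap.congr_fun hh x)⟩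

/-- A finitely generated projective module has a finite dual basis. -/
lemma exists_finite_dual_basis (R M : Type*) [CommRing R] [AddCommGroup M] [Module R M]
    [Module.Finite R M] [Module.Projective R M] :
    ∃ (n : ℕ) (v : Fin n → M) (φ : Fin n → M →ₗ[R] R), ∀ x, ∑ j, φ j x • v j = x := by
  obtain ⟨n, f, g, -, -, hfg⟩ := Module.Finite.exists_comp_eq_id_of_projective R M
  refine ⟨n, fun j ↦ f (Pi.single j 1), fun j ↦ LinearMap.proj j ∘ₗ g, fun x ↦ ?_⟩
  have hx : f (g x) = x := LinearMap.congr_fun hfg x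
  conv_rhs => rw [← hx, ← LinearMap.sum_single_apply (fun _ ↦ R) (g x), map_sum]
  refine Finset.sum_congr rfl fun j _ ↦ ?_
  rw [← map_smul, ← Pi.single_smul, smul_eq_mul, mul_one]
  rfl

/-- If `d` has a generalized inverse `h` and `d`, `d'` stay exact after tensoring with any module,
all modules being finitely generated projective, then `1 - d h` extends along `d'`. The proof tests
exactness on the element of `M₂ ⊗ K` corresponding to the projection of the dual of `M₂` onto the
cokernel `K` of the dual of `d'`. -/
lemma exists_comp_eq_id_sub_of_universally_exact {R M₁ M₂ M₃ : Type} [CommRing R]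
    [AddCommGroup M₁] [AddCommGroup M₂] [AddCommGroup M₃] [Module R M₁] [Module R M₂] [Module R M₃]
    [Module.Finite R M₂] [Module.Projective R M₂] [Module.Finite R M₃] [Module.Projective R M₃]
    {d : M₁ →ₗ[R] M₂} {d' : M₂ →ₗ[R] M₃}
    (hd : ∀ (K : Type) [AddCommGroup K] [Module R K],
      Function.Exact (d.rTensor K) (d'.rTensor K))
    {h : M₂ →ₗ[R] M₁} (hh : ∀ x, d (h (d x)) = d x) :
    ∃ h' : M₃ →ₗ[R] M₂, ∀ x, h' (d' x) = x - d (h x) := by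
  obtain ⟨n, v, φ, hφ⟩ := exists_finite_dual_basis R M₂
  obtain ⟨m, w, θ, hθ⟩ := exists_finite_dual_basis R M₃
  let S : Submodule R (M₂ →ₗ[R] R) := LinearMap.range (LinearMap.lcomp R R d')
  let t : TensorProduct R M₂ ((M₂ →ₗ[R] R) ⧸ S) := ∑ j, v j ⊗ₜ[R] S.mkQ (φ j)
  have hsum : ∀ ψ : M₂ →ₗ[R] R, ∑ j, ψ (v j) • φ j = ψ := fun ψ ↦ by
    ext x
    conv_rhs => rw [← hφ x]
    simp [mul_comm]
  have ht : d'.rTensor _ t = 0 := by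
    have hexp : ∀ j, d' (v j) ⊗ₜ[R] S.mkQ (φ j) =
        ∑ k, w k ⊗ₜ[R] S.mkQ (θ k (d' (v j)) • φ j) := fun j ↦ by
      conv_lhs => rw [← hθ (d' (v j))]
      simp [TensorProduct.sum_tmul, TensorProduct.smul_tmul]
    simp only [t, map_sum, LinearMap.rTensor_tmul, hexp]
    rw [Finset.sum_comm]
    refine Finset.sum_eq_zero fun k _ ↦ ?_
    rw [← TensorProduct.tmul_sum, ← map_sum]
    have hk := hsum (θ k ∘ₗ d')
    simp only [LinearMap.comp_apply] at hk
    have hθS : S.mkQ (θ k ∘ₗ d') = 0 := (Submodule.Quotient.mk_eq_zero S).2 ⟨θ k, rfl⟩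
    rw [hk, hθS, TensorProduct.tmul_zero]
  let e : M₂ →ₗ[R] M₂ := LinearMap.id - d ∘ₗ h
  have hed : e ∘ₗ d = 0 := by ext x; simp [e, hh]
  have het : e.rTensor _ t = 0 := by
    obtain ⟨y, hy⟩ := (hd _ t).1 ht
    rw [← hy, ← LinearMap.comp_apply, ← LinearMap.rTensor_comp, hed]
    simp
  have hmem : ∀ ψ : M₂ →ₗ[R] R, ψ ∘ₗ e ∈ S := fun ψ ↦ by
    rw [← Submodule.Quotient.mk_eq_zero, ← Submodule.mkQ_apply, ← hsum (ψ ∘ₗ e), map_sum]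
    simpa [t] using congrArg (TensorProduct.lid R _ ∘ ψ.rTensor _) het
  choose ψ hψ using fun j ↦ hmem (φ j)
  refine ⟨∑ j, (ψ j).smulRight (v j), fun x ↦ ?_⟩
  have hx : ∀ j, ψ j (d' x) = φ j (e x) := fun j ↦ LinearMap.congr_fun (hψ j) x
  simp only [LinearMap.sum_apply, LinearMap.smulRight_apply, hx, hφ]
  rfl

/-- A morphism to a short complex with zero differentials is a quasi-isomorphism if in the middle
it is a retraction up to homotopy. -/
lemma shortComplex_quasiIso_of_retraction {C : Type*} [Category* C] [Abelian C]
    {S T : ShortComplex C} (F : S ⟶ T) (hf : T.f = 0) (hg : T.g = 0) (i : T.X₂ ⟶ S.X₂)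
    (hi : i ≫ S.g = 0) (hip : i ≫ F.τ₂ = 𝟙 _) (s : S.X₂ ⟶ S.X₁) (t : S.X₃ ⟶ S.X₂)
    (hst : 𝟙 _ = S.g ≫ t + s ≫ S.f + F.τ₂ ≫ i) : ShortComplex.QuasiIso F := by
  let G : T ⟶ S := { τ₁ := 0, τ₂ := i, τ₃ := 0, comm₁₂ := by simp [hf], comm₂₃ := by simp [hi] }
  have hp : S.f ≫ F.τ₂ = 0 := by rw [← F.comm₁₂, hf, comp_zero]
  have hs : S.f ≫ s ≫ S.f = S.f := by
    simpa [reassoc_of% hp] using (S.f ≫= hst).symm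
  have ht : S.g ≫ t ≫ S.g = S.g := by
    simpa [hi] using (hst =≫ S.g).symm
  have hGF : ShortComplex.Homotopy (𝟙 _) (G ≫ F) :=
    { h₀ := 𝟙 _
      h₁ := 0
      h₂ := 0
      h₃ := 𝟙 _
      h₀_f := by simp [hf]
      g_h₃ := by simp [hg]
      comm₁ := by simp [G]
      comm₂ := by simp [G, hip]
      comm₃ := by simp [G] }
  have hFG : ShortComplex.Homotopy (𝟙 _) (F ≫ G) :=
    { h₀ := 𝟙 _ - S.f ≫ s
      h₁ := s
      h₂ := t
      h₃ := 𝟙 _ - t ≫ S.g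
      h₀_f := by simp [hs]
      g_h₃ := by simp [ht]
      comm₁ := by simp [G]
      comm₂ := hst
      comm₃ := by simp [G] }
  rw [ShortComplex.quasiIso_iff]
  refine ⟨ShortComplex.homologyMap G, ?_, ?_⟩
  · rw [← ShortComplex.homologyMap_comp, ← hFG.homologyMap_congr, ShortComplex.homologyMap_id]
  · rw [← ShortComplex.homologyMap_comp, ← hGF.homologyMap_congr, ShortComplex.homologyMap_id]

/-- A cochain complex which in degree `0` retracts onto `Q` up to homotopy maps to `Q` placed in
degree `0` by a morphism inducing an isomorphism on cohomology in degree `0`. -/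
lemma exists_hom_single_quasiIsoAt {C : Type*} [Category* C] [Abelian C]
    (K : CochainComplex C ℤ) {Q : C} (p : K.X 0 ⟶ Q) (i : Q ⟶ K.X 0) (hip : i ≫ p = 𝟙 Q)
    (hp : K.d (-1) 0 ≫ p = 0) (hi : i ≫ K.d 0 1 = 0) (s : K.X 0 ⟶ K.X (-1)) (t : K.X 1 ⟶ K.X 0)
    (hst : 𝟙 _ = K.d 0 1 ≫ t + s ≫ K.d (-1) 0 + p ≫ i) :
    ∃ f : K ⟶ (single C (ComplexShape.up ℤ) 0).obj Q, QuasiIsoAt f 0 := by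
  have hprev : ∀ j, (ComplexShape.up ℤ).Rel j 0 → K.d j 0 ≫ p = 0 := by
    intro j hj
    obtain rfl : j = -1 := by simp at hj; lia
    exact hp
  let f := mkHomToSingle p hprev
  let e := singleObjXSelf (ComplexShape.up ℤ) 0 Q
  have hf : f.f 0 = p ≫ e.inv := mkHomToSingle_f p hprev
  have hretr : (e.hom ≫ i) ≫ f.f 0 = 𝟙 _ := by simp [hf, reassoc_of% hip]
  have hhom : 𝟙 _ = K.d 0 1 ≫ t + s ≫ K.d (-1) 0 + f.f 0 ≫ e.hom ≫ i := by simpa [hf] using hst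
  have hcyc : (e.hom ≫ i) ≫ K.d 0 1 = 0 := by simp [hi]
  exact ⟨f, (quasiIsoAt_iff' f (-1) 0 1 (by simp) (by simp)).2
    (shortComplex_quasiIso_of_retraction _ rfl rfl
      (e.hom ≫ i) hcyc hretr s t hhom)⟩

section TorAmplitude

variable {A : Type} [CommRing A] {P : CochainComplex (ModuleCat.{0} A) ℤ}

/-- Outside the Tor-amplitude, the complex stays exact after tensoring with any module. -/
lemma TorAmpPlain.exact_rTensor {a b : ℤ} (h : TorAmpPlain A P a b) {i j k : ℤ} (hij : i + 1 = j)
    (hjk : j + 1 = k) (hj : j < a ∨ b < j) (K : Type) [AddCommGroup K] [Module A K] :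
    Function.Exact ((P.d i j).hom.rTensor K) ((P.d j k).hom.rTensor K) := by
  have hK := h (ModuleCat.of A K) j hj
  rw [← exactAt_iff_isZero_homology, exactAt_iff' _ i j k (by simp; lia) (by simp; lia),
    ShortComplex.moduleCat_exact_iff_range_eq_ker] at hK
  exact LinearMap.exact_iff.2 hK.symm

/-- Outside the Tor-amplitude, the complex is exact. -/
lemma TorAmpPlain.exact {a b : ℤ} (h : TorAmpPlain A P a b) {i j k : ℤ} (hij : i + 1 = j)
    (hjk : j + 1 = k) (hj : j < a ∨ b < j) :
    Function.Exact (P.d i j).hom (P.d j k).hom := by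
  have hA := h.exact_rTensor hij hjk hj A
  refine (Function.Exact.iff_of_ladder_linearEquiv (e₁ := (TensorProduct.rid A _).symm)
    (e₂ := (TensorProduct.rid A _).symm) (e₃ := (TensorProduct.rid A _).symm) ?_ ?_).1 hA
  · ext x; simp
  · ext x; simp

/-- Above the Tor-amplitude, the differentials of a perfect complex have generalized inverses. -/
lemma exists_generalized_inverse_of_ge {a b : ℤ} (hP : IsPerfectData A P)
    (h : TorAmpPlain A P a b) {i j : ℤ} (hij : i + 1 = j) (hi : b ≤ i) :
    ∃ s : P.X j →ₗ[A] P.X i, ∀ x, (P.d i j).hom (s ((P.d i j).hom x)) = (P.d i j).hom x := by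
  obtain ⟨⟨m, N, hN⟩, hproj⟩ := hP
  obtain ⟨k, hk⟩ : ∃ k : ℕ, N ≤ i + k := ⟨(N - i).toNat, by lia⟩
  induction k generalizing i j with
  | zero =>
    have : Subsingleton (P.X j) := ModuleCat.subsingleton_of_isZero (hN j (by lia))
    exact ⟨0, fun x ↦ Subsingleton.elim _ _⟩
  | succ k ih =>
    obtain ⟨s', hs'⟩ := ih (i := j) rfl (by lia) (by lia)
    have := (hproj j).2
    obtain ⟨s, hs⟩ := exists_comp_eq_id_sub_of_exact (h.exact hij rfl (by lia)) hs'
    refine ⟨s, fun x ↦ ?_⟩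
    rw [hs, (h.exact hij rfl (by lia)).apply_apply_eq_zero, map_zero, sub_zero]

/-- Below the Tor-amplitude, the differentials of a perfect complex have generalized inverses. -/
lemma exists_generalized_inverse_of_lt {a b : ℤ} (hP : IsPerfectData A P)
    (h : TorAmpPlain A P a b) {i j : ℤ} (hij : i + 1 = j) (hi : i < a) :
    ∃ s : P.X j →ₗ[A] P.X i, ∀ x, (P.d i j).hom (s ((P.d i j).hom x)) = (P.d i j).hom x := by
  obtain ⟨⟨m, N, hN⟩, hproj⟩ := hP
  obtain ⟨k, hk⟩ : ∃ k : ℕ, i < m + k := ⟨(i - m + 1).toNat, by lia⟩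
  induction k generalizing i j with
  | zero =>
    have : Subsingleton (P.X i) := ModuleCat.subsingleton_of_isZero (hN i (by lia))
    exact ⟨0, fun x ↦ congrArg _ (Subsingleton.elim _ _)⟩
  | succ k ih =>
    obtain ⟨s, hs⟩ := ih (i := i - 1) (j := i) (by lia) (by lia) (by lia)
    have := (hproj i).1
    have := (hproj i).2
    have := (hproj j).1
    have := (hproj j).2
    obtain ⟨s', hs'⟩ := exists_comp_eq_id_sub_of_universally_exact
      (fun K ↦ h.exact_rTensor (i := i - 1) (by lia) hij (.inl hi) K) hs
    refine ⟨s', fun x ↦ ?_⟩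
    rw [hs', map_sub, (h.exact (i := i - 1) (by lia) hij (.inl hi)).apply_apply_eq_zero, sub_zero]

end TorAmplitude

/-- A bounded complex of finitely generated projective modules over a commutative ring `A`
with Tor-amplitude concentrated in `[0,0]` is quasi-isomorphic to a finitely generated
projective module placed in degree `0`. -/
theorem perfect_torAmp_zero_zero_is_projective_module (A : Type) [CommRing A]
    (P : CochainComplex (ModuleCat.{0} A) ℤ) (hP : IsPerfectData A P)
    (h : TorAmpPlain A P 0 0) :
    ∃ Q : ModuleCat.{0} A, Module.Finite A Q ∧ Module.Projective A Q ∧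
      ∃ f : P ⟶ (HomologicalComplex.single (ModuleCat.{0} A) (ComplexShape.up ℤ) 0).obj Q,
        QuasiIso f := by
  obtain ⟨s, hs⟩ := exists_generalized_inverse_of_lt hP h (i := -1) (j := 0) rfl (by lia)
  obtain ⟨t, ht⟩ := exists_generalized_inverse_of_ge hP h (i := 0) (j := 1) rfl le_rfl
  have hdd : ∀ x, (P.d 0 1).hom ((P.d (-1) 0).hom x) = 0 := fun x ↦
    LinearMap.congr_fun (congrArg ModuleCat.Hom.hom (P.d_comp_d (-1) 0 1)) x
  have := (hP.2 0).1
  have := (hP.2 0).2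
  let a : P.X 0 →ₗ[A] P.X 0 := LinearMap.id - t ∘ₗ (P.d 0 1).hom
  let u : P.X 0 →ₗ[A] P.X 0 := (LinearMap.id - (P.d (-1) 0).hom ∘ₗ s) ∘ₗ a
  have hu : ∀ x, u x = a x - (P.d (-1) 0).hom (s (a x)) := fun _ ↦ rfl
  have ha : ∀ x, a x = x - t ((P.d 0 1).hom x) := fun _ ↦ rfl
  have hdu : ∀ x, (P.d 0 1).hom (u x) = 0 := fun x ↦ by simp [hu, ha, ht, hdd]
  have hud : ∀ x, u ((P.d (-1) 0).hom x) = 0 := fun x ↦ by simp [hu, ha, hs, hdd]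
  have huu : ∀ x, u (u x) = u x := fun x ↦ by
    conv_lhs => rw [hu x, map_sub, hud, sub_zero, hu, ha (a x)]
    have : (P.d 0 1).hom (a x) = 0 := by simp [ha, ht]
    rw [this, map_zero, sub_zero, hu]
  let Q := LinearMap.range u
  have hsplit : u.rangeRestrict ∘ₗ Q.subtype = LinearMap.id := by
    ext ⟨_, y, rfl⟩
    exact huu y
  obtain ⟨f, hf⟩ := exists_hom_single_quasiIsoAt P (Q := ModuleCat.of A Q)
    (ModuleCat.ofHom u.rangeRestrict) (ModuleCat.ofHom Q.subtype)
    (by rw [← ModuleCat.ofHom_comp, hsplit]; rfl)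
    (ModuleCat.hom_ext (LinearMap.ext fun x ↦ Subtype.ext (hud x)))
    (by ext ⟨_, y, rfl⟩; exact hdu y)
    (ModuleCat.ofHom (s ∘ₗ a)) (ModuleCat.ofHom t)
    (by
      ext x
      change x = t ((P.d 0 1).hom x) + (P.d (-1) 0).hom (s (a x)) + u x
      rw [hu, ha]
      abel)
  refine ⟨ModuleCat.of A Q, inferInstanceAs (Module.Finite A (LinearMap.range u)),
    Module.Projective.of_split Q.subtype u.rangeRestrict hsplit, f, ⟨fun i ↦ ?_⟩⟩
  by_cases hi : i = 0
  · subst hi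
    exact hf
  · rw [quasiIsoAt_iff_exactAt' _ _ (exactAt_single_obj _ _ _ _ hi),
      exactAt_iff' _ (i - 1) i (i + 1) (by simp) (by simp),
      ShortComplex.moduleCat_exact_iff_range_eq_ker]
    exact (LinearMap.exact_iff.1 (h.exact (by lia) rfl (by lia))).symm
end

section
/- If F → G → H → F[1] is a distinguished triangle in D(A) with F (n+1)-pseudo-coherent and G n-pseudo-coherent, then H is n-pseudo-coherent. -/
open CategoryTheory Limits MonoidalCategory HomologicalComplex

namespace CategoryTheory.Functor

open Pretriangulated ComposableArrows

variable {C D : Type*} [Category C] [HasShift C ℤ] [HasZeroObject C] [Preadditive C]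
  [∀ n : ℤ, (CategoryTheory.shiftFunctor C n).Additive] [Pretriangulated C]
  [Category D] [Abelian D] (F : C ⥤ D) [F.IsHomological] [F.ShiftSequence ℤ]

/-- The morphism between long exact homology sequences induced by a morphism of triangles. -/
noncomputable def homologySequenceComposableArrows₅Map {T T' : Triangle C} (φ : T ⟶ T')
    (n₀ n₁ : ℤ) (h : n₀ + 1 = n₁) :
    F.homologySequenceComposableArrows₅ T n₀ n₁ h ⟶
      F.homologySequenceComposableArrows₅ T' n₀ n₁ h :=
  homMk₅ ((F.shift n₀).map φ.hom₁) ((F.shift n₀).map φ.hom₂) ((F.shift n₀).map φ.hom₃)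
    ((F.shift n₁).map φ.hom₁) ((F.shift n₁).map φ.hom₂) ((F.shift n₁).map φ.hom₃)
    (((F.shift n₀).map_comp _ _).symm.trans
      ((congrArg _ φ.comm₁).trans ((F.shift n₀).map_comp _ _)))
    (((F.shift n₀).map_comp _ _).symm.trans
      ((congrArg _ φ.comm₂).trans ((F.shift n₀).map_comp _ _)))
    (F.homologySequenceδ_naturality T T' φ n₀ n₁ h).symm
    (((F.shift n₁).map_comp _ _).symm.trans
      ((congrArg _ φ.comm₁).trans ((F.shift n₁).map_comp _ _)))
    (((F.shift n₁).map_comp _ _).symm.trans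
      ((congrArg _ φ.comm₂).trans ((F.shift n₁).map_comp _ _)))

lemma epi_shift_map_hom₃ {T T' : Triangle C} (hT : T ∈ distTriang C) (hT' : T' ∈ distTriang C)
    (φ : T ⟶ T') (n₀ n₁ : ℤ) (h : n₀ + 1 = n₁) (h₀ : Epi ((F.shift n₀).map φ.hom₂))
    (h₁ : Epi ((F.shift n₁).map φ.hom₁)) (h₂ : Mono ((F.shift n₁).map φ.hom₂)) :
    Epi ((F.shift n₀).map φ.hom₃) :=
  Abelian.epi_of_epi_of_epi_of_mono'' (show 1 + 3 ≤ 5 by lia)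
    (F.homologySequenceComposableArrows₅_exact T hT n₀ n₁ h)
    (F.homologySequenceComposableArrows₅_exact T' hT' n₀ n₁ h)
    (F.homologySequenceComposableArrows₅Map φ n₀ n₁ h) 1 2 3 4 rfl rfl rfl rfl h₀ h₁ h₂

lemma mono_shift_map_hom₃ {T T' : Triangle C} (hT : T ∈ distTriang C) (hT' : T' ∈ distTriang C)
    (φ : T ⟶ T') (n₀ n₁ : ℤ) (h : n₀ + 1 = n₁) (h₀ : Epi ((F.shift n₀).map φ.hom₁))
    (h₁ : Mono ((F.shift n₀).map φ.hom₂)) (h₂ : Mono ((F.shift n₁).map φ.hom₁)) :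
    Mono ((F.shift n₀).map φ.hom₃) :=
  Abelian.mono_of_epi_of_mono_of_mono'' (show 0 + 3 ≤ 5 by lia)
    (F.homologySequenceComposableArrows₅_exact T hT n₀ n₁ h)
    (F.homologySequenceComposableArrows₅_exact T' hT' n₀ n₁ h)
    (F.homologySequenceComposableArrows₅Map φ n₀ n₁ h) 0 1 2 3 rfl rfl rfl rfl h₀ h₁ h₂

end CategoryTheory.Functor

namespace HomologicalComplex

variable {ι ι' : Type*} {c : ComplexShape ι} {c' : ComplexShape ι'} {C : Type*} [Category C]
  [HasZeroMorphisms C] [HasZeroObject C]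

lemma stupidTruncXIso_hom_comm (K : HomologicalComplex C c') (e : c.Embedding c') [e.IsRelIff]
    {i j : ι} {i' j' : ι'} (hi : e.f i = i') (hj : e.f j = j') :
    (K.stupidTruncXIso e hi).hom ≫ K.d i' j' =
      (K.stupidTrunc e).d i' j' ≫ (K.stupidTruncXIso e hj).hom := by
  subst hi hj
  have h := (K.restriction e).extend_d_eq e (rfl : e.f i = _) (rfl : e.f j = _)
  rw [← Category.assoc, Iso.eq_comp_inv] at h
  have hX (k : ι) : (K.stupidTruncXIso e (rfl : e.f k = _)).hom =
      ((K.restriction e).extendXIso e rfl).hom := Category.comp_id _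
  rw [hX, hX]
  exact h.symm

end HomologicalComplex

namespace CochainComplex

open CategoryTheory Limits HomologicalComplex Pretriangulated

variable {C : Type*} [Category C] [Abelian C]

section

variable {K L : CochainComplex C ℤ} (f : K ⟶ L) (i : ℤ)

/-- The map induced in homology by a morphism of complexes is isomorphic to the one induced by
its homotopy class. -/
noncomputable def arrowHomologyIso :
    Arrow.mk (((HomotopyCategory.homologyFunctor C (.up ℤ) 0).shift i).map
      ((HomotopyCategory.quotient C (.up ℤ)).map f)) ≅ Arrow.mk (homologyMap f i) :=
  Arrow.isoMk ((HomotopyCategory.homologyFunctorFactors C (.up ℤ) i).app K)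
    ((HomotopyCategory.homologyFunctorFactors C (.up ℤ) i).app L)
    ((HomotopyCategory.homologyFunctorFactors C (.up ℤ) i).hom.naturality f).symm

lemma epi_shift_map_quotient_map_iff :
    Epi (((HomotopyCategory.homologyFunctor C (.up ℤ) 0).shift i).map
      ((HomotopyCategory.quotient C (.up ℤ)).map f)) ↔ Epi (homologyMap f i) :=
  (MorphismProperty.epimorphisms C).arrow_mk_iso_iff (arrowHomologyIso f i)

lemma mono_shift_map_quotient_map_iff :
    Mono (((HomotopyCategory.homologyFunctor C (.up ℤ) 0).shift i).map
      ((HomotopyCategory.quotient C (.up ℤ)).map f)) ↔ Mono (homologyMap f i) :=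
  (MorphismProperty.monomorphisms C).arrow_mk_iso_iff (arrowHomologyIso f i)

lemma exactAt_mappingCone (h₀ : Epi (homologyMap f i)) (h₁ : Mono (homologyMap f (i + 1))) :
    (mappingCone f).ExactAt i := by
  have hT := HomotopyCategory.mappingCone_triangleh_distinguished f
  rw [exactAt_iff_isZero_homology]
  refine IsZero.of_iso ?_
    ((HomotopyCategory.homologyFunctorFactors C (.up ℤ) i).app (mappingCone f)).symm
  exact (Functor.homologySequence_exact₃ (HomotopyCategory.homologyFunctor C (.up ℤ) 0) _ hT
    i _ rfl).isZero_X₂_iff.2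
      ⟨(Functor.homologySequence_epi_shift_map_mor₁_iff _ _ hT _).1
        ((epi_shift_map_quotient_map_iff f i).2 h₀),
      (Functor.homologySequence_mono_shift_map_mor₁_iff _ _ hT _ _ rfl).1
        ((mono_shift_map_quotient_map_iff f (i + 1)).2 h₁)⟩

end

section

variable {K₁ L₁ K₂ L₂ : CochainComplex C ℤ} {φ₁ : K₁ ⟶ L₁} {φ₂ : K₂ ⟶ L₂}
  {a : K₁ ⟶ K₂} {b : L₁ ⟶ L₂} (H : Homotopy (φ₁ ≫ b) (a ≫ φ₂)) (i : ℤ)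

lemma epi_homologyMap_mapOfHomotopy (h₀ : Epi (homologyMap b i))
    (h₁ : Epi (homologyMap a (i + 1))) (h₂ : Mono (homologyMap b (i + 1))) :
    Epi (homologyMap (mappingCone.mapOfHomotopy H) i) := by
  rw [← epi_shift_map_quotient_map_iff] at h₀ h₁ ⊢
  rw [← mono_shift_map_quotient_map_iff] at h₂
  exact Functor.epi_shift_map_hom₃ _ (HomotopyCategory.mappingCone_triangleh_distinguished _)
    (HomotopyCategory.mappingCone_triangleh_distinguished _)
    (mappingCone.trianglehMapOfHomotopy H) i _ rfl h₀ h₁ h₂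

lemma mono_homologyMap_mapOfHomotopy (h₀ : Epi (homologyMap a i))
    (h₁ : Mono (homologyMap b i)) (h₂ : Mono (homologyMap a (i + 1))) :
    Mono (homologyMap (mappingCone.mapOfHomotopy H) i) := by
  rw [← epi_shift_map_quotient_map_iff] at h₀
  rw [← mono_shift_map_quotient_map_iff] at h₁ h₂ ⊢
  exact Functor.mono_shift_map_hom₃ _ (HomotopyCategory.mappingCone_triangleh_distinguished _)
    (HomotopyCategory.mappingCone_triangleh_distinguished _)
    (mappingCone.trianglehMapOfHomotopy H) i _ rfl h₀ h₁ h₂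

end

attribute [local instance] HasDerivedCategory.standard in
lemma quotient_map_eq_zero_of_isKProjective {K L : CochainComplex C ℤ} (f : K ⟶ L) (n : ℤ)
    [K.IsKProjective] [K.IsStrictlyGE (n + 1)] [L.IsLE n] :
    (HomotopyCategory.quotient C (.up ℤ)).map f = 0 := by
  have : IsIso (DerivedCategory.Qh.map
      ((HomotopyCategory.quotient C (.up ℤ)).map (L.ιTruncLE n))) :=
    inferInstanceAs (IsIso (DerivedCategory.Q.map (L.ιTruncLE n)))
  apply (IsKProjective.Qh_map_bijective K _).injective
  obtain ⟨g, hg⟩ := (IsKProjective.Qh_map_bijective K _).surjective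
    (DerivedCategory.Qh.map ((HomotopyCategory.quotient C (.up ℤ)).map f) ≫
      inv (DerivedCategory.Qh.map
        ((HomotopyCategory.quotient C (.up ℤ)).map (L.ιTruncLE n))))
  obtain ⟨g, rfl⟩ := (HomotopyCategory.quotient C (.up ℤ)).map_surjective g
  obtain rfl : g = 0 := by
    ext i
    by_cases hi : i ≤ n
    · exact (K.isZero_of_isStrictlyGE (n + 1) i (by lia)).eq_of_src _ _
    · exact ((L.truncLE n).isZero_of_isStrictlyLE n i (by lia)).eq_of_tgt _ _
  rw [Functor.map_zero, Functor.map_zero, eq_comm, IsIso.comp_inv_eq, zero_comp] at hg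
  rw [hg, Functor.map_zero]

lemma exists_homotopy_lift {K L M : CochainComplex C ℤ} (f : K ⟶ M) (g : L ⟶ M) (n : ℤ)
    [K.IsKProjective] [K.IsStrictlyGE (n + 1)] (hg : (mappingCone g).IsLE n) :
    ∃ l : K ⟶ L, Nonempty (Homotopy (l ≫ g) f) := by
  obtain ⟨l, hl⟩ := Triangle.coyoneda_exact₂ _
    (HomotopyCategory.mappingCone_triangleh_distinguished g)
    ((HomotopyCategory.quotient C (.up ℤ)).map f)
    (((HomotopyCategory.quotient C (.up ℤ)).map_comp _ _).symm.trans
      (quotient_map_eq_zero_of_isKProjective (f ≫ mappingCone.inr g) n))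
  obtain ⟨l, rfl⟩ := (HomotopyCategory.quotient C (.up ℤ)).map_surjective l
  exact ⟨l, ⟨HomotopyCategory.homotopyOfEq _ _
    (((HomotopyCategory.quotient C (.up ℤ)).map_comp _ _).trans hl.symm)⟩⟩

section StupidTruncation

variable (K : CochainComplex C ℤ) (n : ℤ)

/-- The brutal truncation of a cochain complex in degrees `≥ n`. -/
noncomputable abbrev stupidTruncGE : CochainComplex C ℤ :=
  K.stupidTrunc (ComplexShape.embeddingUpIntGE n)

lemma embeddingUpIntGE_f_toNat {n i : ℤ} (hi : n ≤ i) :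
    (ComplexShape.embeddingUpIntGE n).f (i - n).toNat = i := by
  change n + _ = i
  lia

/-- The brutal truncation in degrees `≥ n` agrees with the complex in these degrees. -/
noncomputable def stupidTruncGEXIso {i : ℤ} (hi : n ≤ i) :
    (K.stupidTruncGE n).X i ≅ K.X i :=
  K.stupidTruncXIso _ (embeddingUpIntGE_f_toNat hi)

lemma isZero_stupidTruncGE_X {i : ℤ} (hi : i < n) : IsZero ((K.stupidTruncGE n).X i) :=
  K.isZero_stupidTrunc_X _ _ fun j hj ↦ by change n + _ = i at hj; lia

lemma stupidTruncGEXIso_hom_comm {i j : ℤ} (hi : n ≤ i) (hj : n ≤ j) :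
    (K.stupidTruncGEXIso n hi).hom ≫ K.d i j =
      (K.stupidTruncGE n).d i j ≫ (K.stupidTruncGEXIso n hj).hom :=
  stupidTruncXIso_hom_comm K _ _ _

/-- The inclusion of the brutal truncation in degrees `≥ n`. -/
noncomputable def ιStupidTruncGE : K.stupidTruncGE n ⟶ K where
  f i := if hi : n ≤ i then (K.stupidTruncGEXIso n hi).hom else 0
  comm' i j hij := by
    obtain rfl : i + 1 = j := hij
    by_cases hi : n ≤ i
    · rw [dif_pos hi, dif_pos (by lia : n ≤ i + 1)]
      exact K.stupidTruncGEXIso_hom_comm n hi _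
    · exact (K.isZero_stupidTruncGE_X n (by lia)).eq_of_src _ _

lemma isIso_ιStupidTruncGE_f {i : ℤ} (hi : n ≤ i) : IsIso ((K.ιStupidTruncGE n).f i) := by
  dsimp [ιStupidTruncGE]
  rw [dif_pos hi]
  infer_instance

lemma epi_homologyMap_ιStupidTruncGE {i : ℤ} (hi : n ≤ i) :
    Epi (homologyMap (K.ιStupidTruncGE n) i) := by
  have : IsIso ((shortComplexFunctor C (.up ℤ) i).map (K.ιStupidTruncGE n)).τ₂ :=
    K.isIso_ιStupidTruncGE_f n hi
  have : IsIso ((shortComplexFunctor C (.up ℤ) i).map (K.ιStupidTruncGE n)).τ₃ :=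
    K.isIso_ιStupidTruncGE_f n (by simp; lia)
  exact ShortComplex.epi_homologyMap_of_epi_cyclesMap _

lemma isIso_homologyMap_ιStupidTruncGE {i : ℤ} (hi : n < i) :
    IsIso (homologyMap (K.ιStupidTruncGE n) i) := by
  have : IsIso ((shortComplexFunctor C (.up ℤ) i).map (K.ιStupidTruncGE n)).τ₁ :=
    K.isIso_ιStupidTruncGE_f n (by simp; lia)
  have : IsIso ((shortComplexFunctor C (.up ℤ) i).map (K.ιStupidTruncGE n)).τ₂ :=
    K.isIso_ιStupidTruncGE_f n hi.le
  have : IsIso ((shortComplexFunctor C (.up ℤ) i).map (K.ιStupidTruncGE n)).τ₃ :=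
    K.isIso_ιStupidTruncGE_f n (by simp; lia)
  exact (ShortComplex.quasiIso_iff _).1 (ShortComplex.quasiIso_of_epi_of_isIso_of_mono _)

end StupidTruncation

end CochainComplex

section PseudoCoherent

variable {A : Type} [CommRing A]

lemma IsBoundedC.mappingCone {P Q : CochainComplex (ModuleCat.{0} A) ℤ} (f : P ⟶ Q)
    (hP : IsBoundedC A P) (hQ : IsBoundedC A Q) :
    IsBoundedC A (CochainComplex.mappingCone f) := by
  obtain ⟨m, N, hP⟩ := hP
  obtain ⟨m', N', hQ⟩ := hQ
  refine ⟨min m m' - 1, max N N', fun i hi ↦ ?_⟩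
  refine IsZero.of_iso ?_ (homotopyCofiber.XIsoBiprod f i (i + 1) rfl)
  rw [biprod_isZero_iff]
  exact ⟨hP _ (by lia), hQ _ (by lia)⟩

lemma DegreewiseFGFree.mappingCone {P Q : CochainComplex (ModuleCat.{0} A) ℤ} (f : P ⟶ Q)
    (hP : DegreewiseFGFree A P) (hQ : DegreewiseFGFree A Q) :
    DegreewiseFGFree A (CochainComplex.mappingCone f) := by
  intro i
  obtain ⟨_, _⟩ := hP (i + 1)
  obtain ⟨_, _⟩ := hQ i
  let e := (homotopyCofiber.XIsoBiprod f i (i + 1) rfl ≪≫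
    ModuleCat.biprodIsoProd _ _).toLinearEquiv.symm
  exact ⟨Module.Finite.equiv e, Module.Free.of_equiv e⟩

lemma IsBoundedC.stupidTruncGE {P : CochainComplex (ModuleCat.{0} A) ℤ} (hP : IsBoundedC A P)
    (n : ℤ) : IsBoundedC A (P.stupidTruncGE n) := by
  obtain ⟨m, N, hP⟩ := hP
  refine ⟨m, N, fun i hi ↦ ?_⟩
  by_cases h : n ≤ i
  · exact (hP i hi).of_iso (P.stupidTruncGEXIso n h)
  · exact P.isZero_stupidTruncGE_X n (by lia)

lemma DegreewiseFGFree.stupidTruncGE {P : CochainComplex (ModuleCat.{0} A) ℤ}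
    (hP : DegreewiseFGFree A P) (n : ℤ) : DegreewiseFGFree A (P.stupidTruncGE n) := by
  intro i
  by_cases h : n ≤ i
  · obtain ⟨_, _⟩ := hP i
    let e := (P.stupidTruncGEXIso n h).toLinearEquiv.symm
    exact ⟨Module.Finite.equiv e, Module.Free.of_equiv e⟩
  · have := ModuleCat.subsingleton_of_isZero (P.isZero_stupidTruncGE_X n (i := i) (by lia))
    exact ⟨inferInstance, inferInstance⟩

lemma isKProjective_of_degreewiseFGFree {P : CochainComplex (ModuleCat.{0} A) ℤ}
    (hP : IsBoundedC A P) (hP' : DegreewiseFGFree A P) : P.IsKProjective := by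
  obtain ⟨m, N, hP⟩ := hP
  have : P.IsStrictlyLE N :=
    (CochainComplex.isStrictlyLE_iff _ _).2 fun i hi ↦ hP i (Or.inr hi)
  have (i : ℤ) : Projective (P.X i) := by
    have := (hP' i).2
    exact ModuleCat.projective_of_free (Module.Free.chooseBasis A (P.X i))
  exact CochainComplex.isKProjective_of_projective P N

/-- An `n`-pseudo-coherent complex can be approximated by a complex concentrated in
degrees `≥ n`. -/
lemma NPseudoCoherent.exists_isStrictlyGE {n : ℤ} {F : CochainComplex (ModuleCat.{0} A) ℤ}
    (hF : NPseudoCoherent A n F) :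
    ∃ (P : CochainComplex (ModuleCat.{0} A) ℤ) (f : P ⟶ F), P.IsStrictlyGE n ∧
      IsBoundedC A P ∧ DegreewiseFGFree A P ∧
        (∀ i > n, IsIso (homologyMap f i)) ∧ Epi (homologyMap f n) := by
  obtain ⟨P, f, hb, hfree, hiso, hepi⟩ := hF
  refine ⟨P.stupidTruncGE n, P.ιStupidTruncGE n ≫ f,
    (CochainComplex.isStrictlyGE_iff _ _).2 fun i hi ↦ P.isZero_stupidTruncGE_X n hi,
    hb.stupidTruncGE n, hfree.stupidTruncGE n, fun i hi ↦ ?_, ?_⟩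
  · have := hiso i hi
    have := P.isIso_homologyMap_ιStupidTruncGE n hi
    rw [homologyMap_comp]
    infer_instance
  · have := P.epi_homologyMap_ιStupidTruncGE n le_rfl
    rw [homologyMap_comp]
    exact epi_comp _ _

end PseudoCoherent

/-- If `F → G → H → F[1]` is a distinguished triangle in `D(A)` (realized by a chain map
`f : F ⟶ G` with cone `H`), `F` is `(n+1)`-pseudo-coherent and `G` is `n`-pseudo-coherent,
then `H` is `n`-pseudo-coherent. -/
theorem nPseudoCoherent_cone (A : Type) [CommRing A]
    (F G : CochainComplex (ModuleCat.{0} A) ℤ) (f : F ⟶ G) (n : ℤ)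
    (hF : NPseudoCoherent A (n + 1) F) (hG : NPseudoCoherent A n G) :
    NPseudoCoherent A n (CochainComplex.mappingCone f) := by
  obtain ⟨P, a, _, hPb, hPfree, ha, ha'⟩ := hF.exists_isStrictlyGE
  obtain ⟨Q, b, hQb, hQfree, hb, hb'⟩ := hG
  have := isKProjective_of_degreewiseFGFree hPb hPfree
  have hcone : (CochainComplex.mappingCone b).IsLE n := by
    refine (CochainComplex.isLE_iff _ _).2 fun i hi ↦ ?_
    have := hb i hi
    have := hb (i + 1) (by lia)
    exact CochainComplex.exactAt_mappingCone b i inferInstance inferInstance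
  obtain ⟨l, ⟨H⟩⟩ := CochainComplex.exists_homotopy_lift (a ≫ f) b n hcone
  have hepi (i : ℤ) (hi : n ≤ i) : Epi (homologyMap b i) := by
    obtain rfl | hi := hi.eq_or_lt
    · exact hb'
    · have := hb i hi
      infer_instance
  have haepi (i : ℤ) (hi : n < i) : Epi (homologyMap a i) := by
    obtain rfl | hi := (Int.add_one_le_of_lt hi).eq_or_lt
    · exact ha'
    · have := ha i hi
      infer_instance
  have hcepi (i : ℤ) (hi : n ≤ i) :
      Epi (homologyMap (CochainComplex.mappingCone.mapOfHomotopy H) i) := by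
    have := hb (i + 1) (by lia)
    exact CochainComplex.epi_homologyMap_mapOfHomotopy H i (hepi i hi)
      (haepi (i + 1) (by lia)) inferInstance
  refine ⟨_, CochainComplex.mappingCone.mapOfHomotopy H, hPb.mappingCone l hQb,
    hPfree.mappingCone l hQfree, fun i hi ↦ ?_, hcepi n le_rfl⟩
  have := hb i hi
  have := ha (i + 1) (by lia)
  have := hcepi i hi.le
  have := CochainComplex.mono_homologyMap_mapOfHomotopy H i (haepi i hi)
    inferInstance inferInstance
  exact isIso_of_mono_of_epi _
end

section
/- A direct sum F ⊕ G of complexes in D(A) is n-pseudo-coherent if and only if both F and G are n-pseudo-coherent. -/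
open CategoryTheory Limits MonoidalCategory HomologicalComplex

section Homology

variable {R : Type} [CommRing R] {P F : CochainComplex (ModuleCat.{0} R) ℤ}

lemma exists_cycles_of_d_eq_zero (F : CochainComplex (ModuleCat.{0} R) ℤ) (i : ℤ) (x : F.X i)
    (hx : F.d i (i + 1) x = 0) : ∃ c : F.cycles i, F.iCycles i c = x := by
  have h : (ShortComplex.mk (F.iCycles i) (F.d i (i + 1)) (by simp)).Exact :=
    ShortComplex.exact_of_f_is_kernel _ (F.cyclesIsKernel i (i + 1) (by simp))
  exact (ShortComplex.moduleCat_exact_iff _).1 h x hx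

lemma d_iCycles_apply (F : CochainComplex (ModuleCat.{0} R) ℤ) (i j : ℤ) (c : F.cycles i) :
    F.d i j (F.iCycles i c) = 0 := by
  rw [← ConcreteCategory.comp_apply, F.iCycles_d]; rfl

lemma iCycles_injective (F : CochainComplex (ModuleCat.{0} R) ℤ) (i : ℤ) :
    Function.Injective (F.iCycles i) :=
  (ModuleCat.mono_iff_injective _).1 inferInstance

lemma homologyπ_apply_eq_zero_iff (F : CochainComplex (ModuleCat.{0} R) ℤ) (i : ℤ)
    (c : F.cycles (i + 1)) :
    F.homologyπ (i + 1) c = 0 ↔ ∃ y : F.X i, F.d i (i + 1) y = F.iCycles (i + 1) c := by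
  have h : (ShortComplex.mk (F.toCycles i (i + 1)) (F.homologyπ (i + 1)) (by simp)).Exact :=
    ShortComplex.exact_of_g_is_cokernel _ (F.homologyIsCokernel i (i + 1) (by simp))
  constructor
  · intro hc
    obtain ⟨y, hy⟩ := (ShortComplex.moduleCat_exact_iff _).1 h c hc
    refine ⟨y, ?_⟩
    rw [← F.toCycles_i, ConcreteCategory.comp_apply]
    exact congrArg _ hy
  · rintro ⟨y, hy⟩
    have : c = F.toCycles i (i + 1) y := by
      apply iCycles_injective
      rw [← hy, ← ConcreteCategory.comp_apply, F.toCycles_i]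
    rw [this, ← ConcreteCategory.comp_apply, F.toCycles_comp_homologyπ]; rfl

lemma homologyπ_surjective (F : CochainComplex (ModuleCat.{0} R) ℤ) (i : ℤ) :
    Function.Surjective (F.homologyπ i) :=
  (ModuleCat.epi_iff_surjective _).1 inferInstance

lemma homologyMap_homologyπ_apply (f : P ⟶ F) (i : ℤ) (c : P.cycles i) :
    homologyMap f i (P.homologyπ i c) = F.homologyπ i (cyclesMap f i c) := by
  rw [← ConcreteCategory.comp_apply, homologyπ_naturality, ConcreteCategory.comp_apply]

lemma iCycles_cyclesMap_apply (f : P ⟶ F) (i : ℤ) (c : P.cycles i) :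
    F.iCycles i (cyclesMap f i c) = f.f i (P.iCycles i c) := by
  rw [← ConcreteCategory.comp_apply, cyclesMap_i, ConcreteCategory.comp_apply]

lemma epi_homologyMap_iff (f : P ⟶ F) (i : ℤ) :
    Epi (homologyMap f (i + 1)) ↔ ∀ x : F.X (i + 1), F.d (i + 1) (i + 1 + 1) x = 0 →
      ∃ (q : P.X (i + 1)) (y : F.X i), P.d (i + 1) (i + 1 + 1) q = 0 ∧
        x = f.f (i + 1) q + F.d i (i + 1) y := by
  rw [ModuleCat.epi_iff_surjective]
  constructor
  · intro h x hx
    obtain ⟨c, rfl⟩ := exists_cycles_of_d_eq_zero F _ x hx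
    obtain ⟨z, hz⟩ := h (F.homologyπ _ c)
    obtain ⟨b, rfl⟩ := homologyπ_surjective P _ z
    rw [homologyMap_homologyπ_apply, eq_comm, ← sub_eq_zero, ← map_sub,
      homologyπ_apply_eq_zero_iff] at hz
    obtain ⟨y, hy⟩ := hz
    refine ⟨P.iCycles _ b, y, d_iCycles_apply _ _ _ _, ?_⟩
    rw [hy, map_sub, iCycles_cyclesMap_apply]
    abel
  · intro h z
    obtain ⟨c, rfl⟩ := homologyπ_surjective F _ z
    obtain ⟨q, y, hq, hy⟩ := h _ (d_iCycles_apply F _ _ c)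
    obtain ⟨b, rfl⟩ := exists_cycles_of_d_eq_zero P _ q hq
    refine ⟨P.homologyπ _ b, ?_⟩
    rw [homologyMap_homologyπ_apply, eq_comm, ← sub_eq_zero, ← map_sub,
      homologyπ_apply_eq_zero_iff]
    refine ⟨y, ?_⟩
    rw [map_sub, iCycles_cyclesMap_apply, hy]
    abel

lemma mono_homologyMap_iff (f : P ⟶ F) (i : ℤ) :
    Mono (homologyMap f (i + 1)) ↔ ∀ (p : P.X (i + 1)) (x : F.X i),
      P.d (i + 1) (i + 1 + 1) p = 0 → F.d i (i + 1) x = f.f (i + 1) p →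
        ∃ q : P.X i, P.d i (i + 1) q = p := by
  rw [ModuleCat.mono_iff_injective, injective_iff_map_eq_zero]
  constructor
  · intro h p x hp hx
    obtain ⟨c, rfl⟩ := exists_cycles_of_d_eq_zero P _ p hp
    rw [← homologyπ_apply_eq_zero_iff]
    apply h
    rw [homologyMap_homologyπ_apply, homologyπ_apply_eq_zero_iff]
    exact ⟨x, by rw [hx, iCycles_cyclesMap_apply]⟩
  · intro h z hz
    obtain ⟨c, rfl⟩ := homologyπ_surjective P _ z
    rw [homologyMap_homologyπ_apply, homologyπ_apply_eq_zero_iff] at hz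
    obtain ⟨x, hx⟩ := hz
    rw [homologyπ_apply_eq_zero_iff]
    exact h _ x (d_iCycles_apply _ _ _ _) (by rw [hx, iCycles_cyclesMap_apply])

/-- The mapping cone of `f` is acyclic in degrees `≥ n`, spelled out on elements. -/
def IsApprox (n : ℤ) (f : P ⟶ F) : Prop :=
  ∀ i : ℤ, n ≤ i + 1 → ∀ (x : F.X (i + 1)) (p : P.X (i + 1 + 1)),
    P.d (i + 1 + 1) (i + 1 + 1 + 1) p = 0 →
    F.d (i + 1) (i + 1 + 1) x = f.f (i + 1 + 1) p →
    ∃ (q : P.X (i + 1)) (y : F.X i), P.d (i + 1) (i + 1 + 1) q = p ∧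
      x = f.f (i + 1) q + F.d i (i + 1) y

lemma isApprox_iff (n : ℤ) (f : P ⟶ F) :
    IsApprox n f ↔ (∀ i > n, IsIso (homologyMap f i)) ∧ Epi (homologyMap f n) := by
  constructor
  · intro h
    have hepi : ∀ i, n ≤ i → Epi (homologyMap f i) := by
      intro i hi
      obtain ⟨i, rfl⟩ : ∃ j, i = j + 1 := ⟨i - 1, by ring⟩
      rw [epi_homologyMap_iff]
      intro x hx
      exact h i hi x 0 (map_zero _) (by rw [hx, map_zero])
    refine ⟨fun i hi => ?_, hepi n le_rfl⟩
    have hmono : Mono (homologyMap f i) := by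
      obtain ⟨i, rfl⟩ : ∃ j, i = j + 1 + 1 := ⟨i - 2, by ring⟩
      rw [mono_homologyMap_iff]
      intro p x hp hx
      obtain ⟨q, -, hq, -⟩ := h i (by omega) x p hp hx
      exact ⟨q, hq⟩
    have := hepi i hi.le
    exact isIso_of_mono_of_epi _
  · rintro ⟨hiso, hepi⟩ i hi x p hp hx
    have hmono : Mono (homologyMap f (i + 1 + 1)) := by
      have := hiso (i + 1 + 1) (by omega)
      infer_instance
    obtain ⟨q, hq⟩ := (mono_homologyMap_iff f (i + 1)).1 hmono p x hp hx
    have he : Epi (homologyMap f (i + 1)) := by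
      rcases hi.eq_or_lt with rfl | hi
      · exact hepi
      · have := hiso (i + 1) hi
        infer_instance
    obtain ⟨r, y, hr, hy⟩ := (epi_homologyMap_iff f i).1 he (x - f.f (i + 1) q) (by
      rw [map_sub, hx, ← hq, ← ConcreteCategory.comp_apply, ← ConcreteCategory.comp_apply,
        f.comm, sub_self])
    refine ⟨q + r, y, by rw [map_add, hq, hr, add_zero], ?_⟩
    rw [map_add, add_assoc, ← hy]
    abel

lemma nPseudoCoherent_iff_exists_isApprox (n : ℤ) (F : CochainComplex (ModuleCat.{0} R) ℤ) :
    NPseudoCoherent R n F ↔ ∃ (P : CochainComplex (ModuleCat.{0} R) ℤ) (f : P ⟶ F),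
      IsBoundedC R P ∧ DegreewiseFGFree R P ∧ IsApprox n f := by
  simp only [NPseudoCoherent, isApprox_iff]

end Homology

section OfModules

variable {R : Type} [CommRing R]

lemma d_d_apply (F : CochainComplex (ModuleCat.{0} R) ℤ) (i j k : ℤ) (x : F.X i) :
    F.d j k (F.d i j x) = 0 := by
  rw [← ConcreteCategory.comp_apply, F.d_comp_d]; rfl

lemma hom_d_apply {P F : CochainComplex (ModuleCat.{0} R) ℤ} (f : P ⟶ F) (i j : ℤ) (x : P.X i) :
    f.f j (P.d i j x) = F.d i j (f.f i x) := by
  rw [← ConcreteCategory.comp_apply, ← ConcreteCategory.comp_apply, f.comm]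

/-- A morphism of cochain complexes from a family of linear maps. -/
def homOfLinearMaps {P F : CochainComplex (ModuleCat.{0} R) ℤ} (f : ∀ i, P.X i →ₗ[R] F.X i)
    (hf : ∀ i x, f (i + 1) (P.d i (i + 1) x) = F.d i (i + 1) (f i x)) : P ⟶ F :=
  CochainComplex.ofHom (fun i => ModuleCat.ofHom (f i)) fun i => by
    ext x
    exact (hf i x).symm

@[simp]
lemma homOfLinearMaps_f_apply {P F : CochainComplex (ModuleCat.{0} R) ℤ}
    (f : ∀ i, P.X i →ₗ[R] F.X i)
    (hf : ∀ i x, f (i + 1) (P.d i (i + 1) x) = F.d i (i + 1) (f i x)) (i : ℤ) (x : P.X i) :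
    (homOfLinearMaps f hf).f i x = f i x :=
  rfl

variable (M : ℤ → Type) [∀ i, AddCommGroup (M i)] [∀ i, Module R (M i)]
  (d : ∀ i, M i →ₗ[R] M (i + 1)) (hd : ∀ i x, d (i + 1) (d i x) = 0)

/-- The cochain complex with terms `M i` and differentials `d i`. -/
noncomputable def ofModules : CochainComplex (ModuleCat.{0} R) ℤ :=
  CochainComplex.of (fun i => ModuleCat.of R (M i)) (fun i => ModuleCat.ofHom (d i)) fun i => by
    ext x
    exact hd i x

/-- The terms of `ofModules M d hd`. -/
noncomputable def ofModulesEquiv (i : ℤ) : M i ≃ₗ[R] (ofModules M d hd).X i :=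
  LinearEquiv.refl R (M i)

@[simp]
lemma ofModules_d_apply (i : ℤ) (x : M i) :
    (ofModules M d hd).d i (i + 1) (ofModulesEquiv M d hd i x) =
      ofModulesEquiv M d hd (i + 1) (d i x) := by
  have h : (ofModules M d hd).d i (i + 1) = ModuleCat.ofHom (d i) :=
    CochainComplex.of_d (fun i => ModuleCat.of R (M i)) (fun i => ModuleCat.ofHom (d i)) i
  rw [h]
  rfl

lemma ofModules_degreewiseFGFree (h : ∀ i, Module.Finite R (M i) ∧ Module.Free R (M i)) :
    DegreewiseFGFree R (ofModules M d hd) := h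

lemma isZero_ofModules_X (i : ℤ) (h : Subsingleton (M i)) : IsZero ((ofModules M d hd).X i) :=
  ModuleCat.isZero_of_iff_subsingleton.2 h

end OfModules

section Cells

variable {R : Type} [CommRing R]

section

variable (F : CochainComplex (ModuleCat.{0} R) ℤ)
  (E : ℤ → Type) [∀ i, AddCommGroup (E i)] [∀ i, Module R (E i)]
  (θ : ∀ i, E i →ₗ[R] F.X i)

/-- The differential of the mapping cone of `θ`, where `E` has zero differential. -/
def cellConeD (i : ℤ) : (E (i + 1) × F.X i) →ₗ[R] (E (i + 1 + 1) × F.X (i + 1)) :=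
  LinearMap.prod 0 ((F.d i (i + 1)).hom ∘ₗ LinearMap.snd R _ _ + θ (i + 1) ∘ₗ LinearMap.fst R _ _)

lemma cellConeD_cellConeD (hθ : ∀ i e, F.d i (i + 1) (θ i e) = 0) (i : ℤ)
    (z : E (i + 1) × F.X i) :
    cellConeD F E θ (i + 1) (cellConeD F E θ i z) = 0 := by
  simp [cellConeD, d_d_apply, hθ]

variable (hθ : ∀ i e, F.d i (i + 1) (θ i e) = 0)

/-- The mapping cone of `θ`, where `E` is viewed as a complex with zero differential. -/
noncomputable def cellCone : CochainComplex (ModuleCat.{0} R) ℤ :=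
  ofModules (fun i => E (i + 1) × F.X i) (cellConeD F E θ) (cellConeD_cellConeD F E θ hθ)

/-- The terms of the mapping cone. -/
noncomputable def cellConeEquiv (i : ℤ) :
    (E (i + 1) × F.X i) ≃ₗ[R] (cellCone F E θ hθ).X i :=
  ofModulesEquiv (fun i => E (i + 1) × F.X i) (cellConeD F E θ) (cellConeD_cellConeD F E θ hθ) i

@[simp]
lemma cellCone_d_apply (i : ℤ) (e : E (i + 1)) (x : F.X i) :
    (cellCone F E θ hθ).d i (i + 1) (cellConeEquiv F E θ hθ i (e, x)) =
      cellConeEquiv F E θ hθ (i + 1) (0, F.d i (i + 1) x + θ (i + 1) e) :=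
  ofModules_d_apply (fun i => E (i + 1) × F.X i) (cellConeD F E θ)
    (cellConeD_cellConeD F E θ hθ) i (e, x)

end

lemma IsBoundedC.subsingleton {P : CochainComplex (ModuleCat.{0} R) ℤ} (h : IsBoundedC R P) :
    ∃ a b : ℤ, ∀ i, (i < a ∨ b < i) → Subsingleton (P.X i) := by
  obtain ⟨a, b, h⟩ := h
  exact ⟨a, b, fun i hi => ModuleCat.isZero_of_iff_subsingleton.1 (h i hi)⟩

variable {F G : CochainComplex (ModuleCat.{0} R) ℤ}
  {E : ℤ → Type} [∀ i, AddCommGroup (E i)] [∀ i, Module R (E i)]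
  {E' : ℤ → Type} [∀ i, AddCommGroup (E' i)] [∀ i, Module R (E' i)]

lemma nPseudoCoherent_cellCone {n N : ℤ} [∀ i, Module.Finite R (E i)] [∀ i, Module.Free R (E i)]
    (hE : ∀ i, (i < n ∨ N < i) → Subsingleton (E i))
    (θ : ∀ i, E i →ₗ[R] F.X i) (hθ : ∀ i e, F.d i (i + 1) (θ i e) = 0)
    (hF : NPseudoCoherent R n F) : NPseudoCoherent R n (cellCone F E θ hθ) := by
  rw [nPseudoCoherent_iff_exists_isApprox] at hF ⊢
  obtain ⟨M, v, hb, hfree, hv⟩ := hF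
  have hlift : ∀ i, ∃ (b : E (i + 1) →ₗ[R] M.X (i + 1)) (h : E (i + 1) →ₗ[R] F.X i),
      (∀ e, M.d (i + 1) (i + 1 + 1) (b e) = 0) ∧
      ∀ e, θ (i + 1) e = v.f (i + 1) (b e) + F.d i (i + 1) (h e) := by
    intro i
    by_cases hi : n ≤ i + 1
    · let B := Module.Free.chooseBasis R (E (i + 1))
      have hB : ∀ k, ∃ (q : M.X (i + 1)) (y : F.X i), M.d (i + 1) (i + 1 + 1) q = 0 ∧
          θ (i + 1) (B k) = v.f (i + 1) q + F.d i (i + 1) y := fun k =>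
        hv i hi (θ (i + 1) (B k)) 0 (map_zero _) (by rw [hθ, map_zero])
      choose q y hq hy using hB
      refine ⟨B.constr R q, B.constr R y, fun e => ?_, fun e => ?_⟩
      · have : (M.d (i + 1) (i + 1 + 1)).hom ∘ₗ B.constr R q = 0 :=
          B.ext fun k => by simp [hq]
        exact LinearMap.congr_fun this e
      · have : θ (i + 1) = (v.f (i + 1)).hom ∘ₗ B.constr R q +
            (F.d i (i + 1)).hom ∘ₗ B.constr R y :=
          B.ext fun k => by simp [hy]
        exact LinearMap.congr_fun this e
    · have := hE (i + 1) (by omega)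
      refine ⟨0, 0, fun e => by simp, fun e => ?_⟩
      rw [Subsingleton.elim e 0]
      simp
  have hlift' : ∀ j, ∃ b : E j →ₗ[R] M.X j, (∀ e, M.d j (j + 1) (b e) = 0) ∧
      ∀ i (hi : i + 1 = j), ∃ h : E (i + 1) →ₗ[R] F.X i,
        ∀ e, θ (i + 1) e = v.f (i + 1) (hi ▸ b (hi ▸ e)) + F.d i (i + 1) (h e) := by
    intro j
    obtain ⟨i, rfl⟩ : ∃ i, j = i + 1 := ⟨j - 1, by ring⟩
    obtain ⟨b, h, h1, h2⟩ := hlift i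
    refine ⟨b, h1, fun i' hi => ?_⟩
    obtain rfl : i' = i := by omega
    exact ⟨h, h2⟩
  choose b hb0 hbh using hlift'
  choose h hh using fun i => hbh (i + 1) i rfl
  dsimp only at hh
  refine ⟨cellCone M E b hb0, homOfLinearMaps
    (fun i => (cellConeEquiv F E θ hθ i).toLinearMap ∘ₗ
      LinearMap.prod (LinearMap.fst R _ _)
        ((v.f i).hom ∘ₗ LinearMap.snd R _ _ - h i ∘ₗ LinearMap.fst R _ _) ∘ₗ
      (cellConeEquiv M E b hb0 i).symm.toLinearMap) ?_, ?_, ?_, ?_⟩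
  · intro i x
    obtain ⟨⟨e, m⟩, rfl⟩ := (cellConeEquiv M E b hb0 i).surjective x
    simp [hh, hom_d_apply]
  · obtain ⟨a, c, hac⟩ := hb.subsingleton
    refine ⟨min (n - 1) a, max N c, fun i hi => isZero_ofModules_X _ _ _ _ ?_⟩
    have := hE (i + 1) (by omega)
    have := hac i (by omega)
    infer_instance
  · refine ofModules_degreewiseFGFree _ _ _ fun i => ?_
    have := (hfree i).1
    have := (hfree i).2
    exact ⟨inferInstance, inferInstance⟩
  · intro i hi x p hp hxp
    obtain ⟨⟨e, x⟩, rfl⟩ := (cellConeEquiv F E θ hθ (i + 1)).surjective x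
    obtain ⟨⟨e₁, m⟩, rfl⟩ := (cellConeEquiv M E b hb0 (i + 1 + 1)).surjective p
    simp only [cellCone_d_apply, homOfLinearMaps_f_apply, LinearMap.coe_comp, Function.comp_apply,
      LinearEquiv.coe_coe, LinearEquiv.symm_apply_apply, LinearMap.prod_apply, Function.prod,
      LinearMap.sub_apply, LinearMap.fst_apply, LinearMap.snd_apply,
      EmbeddingLike.apply_eq_iff_eq, LinearEquiv.map_eq_zero_iff, Prod.mk.injEq,
      Prod.mk_eq_zero] at hp hxp
    obtain ⟨rfl, hx⟩ := hxp
    simp only [map_zero, add_zero, sub_zero, true_and] at hp hx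
    obtain ⟨q, y, hq, hy⟩ := hv i hi (x + h (i + 1) e) (m - b _ e)
      (by rw [map_sub, hp, hb0, sub_zero])
      (by rw [map_add, map_sub]
          rw [hh] at hx
          rw [← hx]
          abel)
    refine ⟨cellConeEquiv M E b hb0 (i + 1) (e, q), cellConeEquiv F E θ hθ i (0, y), ?_, ?_⟩
    · simp [hq]
    · rw [eq_sub_of_add_eq hy]
      simp [← map_add]
      abel

lemma nPseudoCoherent_of_cellCone {n a b : ℤ} [∀ i, Module.Finite R (E i)]
    [∀ i, Module.Free R (E i)] (hE : ∀ i, (i < a ∨ b < i) → Subsingleton (E i))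
    (θ : ∀ i, E i →ₗ[R] F.X i) (hθ : ∀ i e, F.d i (i + 1) (θ i e) = 0)
    (hC : NPseudoCoherent R n (cellCone F E θ hθ)) : NPseudoCoherent R n F := by
  rw [nPseudoCoherent_iff_exists_isApprox] at hC ⊢
  obtain ⟨M, w, hb, hfree, hw⟩ := hC
  let ε : ∀ i, M.X i →ₗ[R] E (i + 1) := fun i =>
    LinearMap.fst R _ _ ∘ₗ (cellConeEquiv F E θ hθ i).symm.toLinearMap ∘ₗ (w.f i).hom
  let v : ∀ i, M.X i →ₗ[R] F.X i := fun i =>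
    LinearMap.snd R _ _ ∘ₗ (cellConeEquiv F E θ hθ i).symm.toLinearMap ∘ₗ (w.f i).hom
  have hwv : ∀ i m, w.f i m = cellConeEquiv F E θ hθ i (ε i m, v i m) := by
    intro i m
    simp [ε, v]
  have hcomm : ∀ i m, ε (i + 1) (M.d i (i + 1) m) = 0 ∧
      v (i + 1) (M.d i (i + 1) m) = F.d i (i + 1) (v i m) + θ (i + 1) (ε i m) := by
    intro i m
    have := hom_d_apply w i (i + 1) m
    rw [hwv, hwv, cellCone_d_apply, EmbeddingLike.apply_eq_iff_eq, Prod.mk.injEq] at this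
    exact this
  let d : ∀ i, (M.X i × E i) →ₗ[R] (M.X (i + 1) × E (i + 1)) := fun i =>
    LinearMap.prod ((M.d i (i + 1)).hom ∘ₗ LinearMap.fst R _ _) (ε i ∘ₗ LinearMap.fst R _ _)
  have hd : ∀ i x, d (i + 1) (d i x) = 0 := fun i x => by
    simp [d, d_d_apply, (hcomm i _).1]
  refine ⟨ofModules (fun i => M.X i × E i) d hd, homOfLinearMaps
    (fun i => (v i ∘ₗ LinearMap.fst R _ _ - θ i ∘ₗ LinearMap.snd R _ _) ∘ₗ
      (ofModulesEquiv (fun i => M.X i × E i) d hd i).symm.toLinearMap) ?_, ?_, ?_, ?_⟩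
  · intro i x
    obtain ⟨⟨m, e⟩, rfl⟩ := (ofModulesEquiv (fun i => M.X i × E i) d hd i).surjective x
    simp [d, (hcomm i m).2, hθ]
  · obtain ⟨a', b', hab⟩ := hb.subsingleton
    refine ⟨min a a', max b b', fun i hi => isZero_ofModules_X _ _ _ _ ?_⟩
    have := hE i (by omega)
    have := hab i (by omega)
    infer_instance
  · refine ofModules_degreewiseFGFree _ _ _ fun i => ?_
    have := (hfree i).1
    have := (hfree i).2
    exact ⟨inferInstance, inferInstance⟩
  · intro i hi x p hp hxp
    obtain ⟨⟨p, e⟩, rfl⟩ :=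
      (ofModulesEquiv (fun i => M.X i × E i) d hd (i + 1 + 1)).surjective p
    simp [d] at hp hxp
    obtain ⟨q, z, hq, hz⟩ := hw i hi (cellConeEquiv F E θ hθ (i + 1) (e, x)) p hp.1
      (by simp [hwv, hp.2, hxp])
    obtain ⟨⟨e₁, y⟩, rfl⟩ := (cellConeEquiv F E θ hθ i).surjective z
    rw [hwv, cellCone_d_apply, ← map_add, EmbeddingLike.apply_eq_iff_eq, Prod.mk_add_mk,
      Prod.mk.injEq, add_zero] at hz
    refine ⟨ofModulesEquiv (fun i => M.X i × E i) d hd (i + 1) (q, -e₁), y, ?_, ?_⟩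
    · simp [d, hq, hz.1]
    · rw [hz.2]
      simp
      abel

/-- The morphism of mapping cones induced by a commutative square. -/
noncomputable def cellConeMap {θ : ∀ i, E i →ₗ[R] F.X i} {hθ : ∀ i e, F.d i (i + 1) (θ i e) = 0}
    {θ' : ∀ i, E' i →ₗ[R] G.X i} {hθ' : ∀ i e, G.d i (i + 1) (θ' i e) = 0}
    (a : ∀ i, E i →ₗ[R] E' i) (f : F ⟶ G) (h : ∀ i e, f.f i (θ i e) = θ' i (a i e)) :
    cellCone F E θ hθ ⟶ cellCone G E' θ' hθ' :=
  homOfLinearMaps (fun i => (cellConeEquiv G E' θ' hθ' i).toLinearMap ∘ₗ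
    LinearMap.prodMap (a (i + 1)) (f.f i).hom ∘ₗ
    (cellConeEquiv F E θ hθ i).symm.toLinearMap) fun i x => by
      obtain ⟨⟨e, x⟩, rfl⟩ := (cellConeEquiv F E θ hθ i).surjective x
      simp [hom_d_apply, h]

@[simp]
lemma cellConeMap_f_apply {θ : ∀ i, E i →ₗ[R] F.X i} {hθ : ∀ i e, F.d i (i + 1) (θ i e) = 0}
    {θ' : ∀ i, E' i →ₗ[R] G.X i} {hθ' : ∀ i e, G.d i (i + 1) (θ' i e) = 0}
    (a : ∀ i, E i →ₗ[R] E' i) (f : F ⟶ G) (h : ∀ i e, f.f i (θ i e) = θ' i (a i e))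
    (i : ℤ) (e : E (i + 1)) (x : F.X i) :
    (cellConeMap (hθ := hθ) (hθ' := hθ') a f h).f i (cellConeEquiv F E θ hθ i (e, x)) =
      cellConeEquiv G E' θ' hθ' i (a (i + 1) e, f.f i x) := by
  simp [cellConeMap]

end Cells

section Retract

variable {R : Type} [CommRing R]

/-- Every cocycle of degree `i + 1` is a coboundary. -/
def IsAcyclicAtSucc (F : CochainComplex (ModuleCat.{0} R) ℤ) (i : ℤ) : Prop :=
  ∀ x : F.X (i + 1), F.d (i + 1) (i + 1 + 1) x = 0 → ∃ y : F.X i, x = F.d i (i + 1) y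

lemma finite_projective_ker_of_surjective {M N : Type} [AddCommGroup M] [Module R M]
    [AddCommGroup N] [Module R N] [Module.Finite R M] [Module.Projective R M]
    [Module.Projective R N] (f : M →ₗ[R] N) (hf : Function.Surjective f) :
    Module.Finite R (LinearMap.ker f) ∧ Module.Projective R (LinearMap.ker f) := by
  obtain ⟨s, hs⟩ := Module.projective_lifting_property f LinearMap.id hf
  have hs' : ∀ y, f (s y) = y := LinearMap.congr_fun hs
  let p : M →ₗ[R] LinearMap.ker f :=
    (LinearMap.id - s ∘ₗ f).codRestrict _ fun x => by simp [hs']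
  have hp : p ∘ₗ (LinearMap.ker f).subtype = LinearMap.id := by
    ext x
    simp [p]
  exact ⟨Module.Finite.of_surjective p fun x => ⟨x, LinearMap.congr_fun hp x⟩,
    Module.Projective.of_split _ p hp⟩

lemma finite_projective_cocycles {P : CochainComplex (ModuleCat.{0} R) ℤ} (hP : IsBoundedC R P)
    (hfree : DegreewiseFGFree R P) (N : ℤ) (hN : ∀ i, N ≤ i → IsAcyclicAtSucc P i) :
    Module.Finite R (LinearMap.ker (P.d N (N + 1)).hom) ∧
      Module.Projective R (LinearMap.ker (P.d N (N + 1)).hom) := by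
  obtain ⟨a, b, hab⟩ := hP.subsingleton
  suffices ∀ (k : ℕ) (i : ℤ), N ≤ i → b < i + k →
      Module.Finite R (LinearMap.ker (P.d i (i + 1)).hom) ∧
        Module.Projective R (LinearMap.ker (P.d i (i + 1)).hom) from
    this (b + 1 - N).toNat N le_rfl (by omega)
  intro k
  induction k with
  | zero =>
    intro i _ hi
    have := hab i (Or.inr (by simpa using hi))
    exact ⟨inferInstance, inferInstance⟩
  | succ k ih =>
    intro i hNi hi
    have hproj := (ih (i + 1) (by omega) (by push_cast at hi; omega)).2
    have := (hfree i).1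
    have := (hfree i).2
    let f : P.X i →ₗ[R] LinearMap.ker (P.d (i + 1) (i + 1 + 1)).hom :=
      (P.d i (i + 1)).hom.codRestrict _ fun x => d_d_apply P _ _ _ x
    have hf : Function.Surjective f := by
      rintro ⟨x, hx⟩
      obtain ⟨y, rfl⟩ := hN i hNi x hx
      exact ⟨y, rfl⟩
    have hker : LinearMap.ker f = LinearMap.ker (P.d i (i + 1)).hom :=
      LinearMap.ker_codRestrict _ _ _
    rw [← hker]
    exact finite_projective_ker_of_surjective f hf

/-- The top cohomology of an `n`-pseudo-coherent complex is finitely generated. -/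
lemma NPseudoCoherent.exists_generators {n N : ℤ} {F : CochainComplex (ModuleCat.{0} R) ℤ}
    (hF : NPseudoCoherent R n F) (hn : n ≤ N + 1)
    (hN : ∀ i, N + 1 ≤ i → IsAcyclicAtSucc F i) :
    ∃ (m : ℕ) (t : (Fin m → R) →ₗ[R] F.X (N + 1)),
      (∀ e, F.d (N + 1) (N + 1 + 1) (t e) = 0) ∧
      ∀ x : F.X (N + 1), F.d (N + 1) (N + 1 + 1) x = 0 →
        ∃ (e : Fin m → R) (y : F.X N), x = t e + F.d N (N + 1) y := by
  obtain ⟨P, v, hP, hfree, hv⟩ := (nPseudoCoherent_iff_exists_isApprox n F).1 hF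
  have hacyc : ∀ i, N + 1 ≤ i → IsAcyclicAtSucc P i := by
    intro i hi p hp
    obtain ⟨i, rfl⟩ : ∃ j, i = j + 1 := ⟨i - 1, by ring⟩
    obtain ⟨x, hx⟩ := hN _ hi (v.f _ p) (by rw [← hom_d_apply, hp, map_zero])
    obtain ⟨q, -, hq, -⟩ := hv i (by omega) x p hp hx.symm
    exact ⟨q, hq.symm⟩
  have := (finite_projective_cocycles hP hfree (N + 1) hacyc).1
  obtain ⟨m, g, hg⟩ := Module.Finite.exists_fin' R (LinearMap.ker (P.d (N + 1) (N + 1 + 1)).hom)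
  refine ⟨m, (v.f (N + 1)).hom ∘ₗ Submodule.subtype _ ∘ₗ g, fun e => ?_, fun x hx => ?_⟩
  · have h : P.d (N + 1) (N + 1 + 1) (g e).1 = 0 := (g e).2
    change F.d (N + 1) (N + 1 + 1) (v.f (N + 1) (g e).1) = 0
    rw [← hom_d_apply, h, map_zero]
  · obtain ⟨q, y, hq, hy⟩ := hv N hn x 0 (map_zero _) (by rw [hx, map_zero])
    obtain ⟨e, he⟩ := hg ⟨q, hq⟩
    refine ⟨e, y, ?_⟩
    rw [hy]
    simp [he]

lemma NPseudoCoherent.exists_isAcyclicAtSucc {n : ℤ} {F : CochainComplex (ModuleCat.{0} R) ℤ}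
    (hF : NPseudoCoherent R n F) :
    ∃ k : ℕ, ∀ i, n + k ≤ i + 1 → IsAcyclicAtSucc F i := by
  obtain ⟨P, v, hP, hfree, hv⟩ := (nPseudoCoherent_iff_exists_isApprox n F).1 hF
  obtain ⟨a, b, hab⟩ := hP.subsingleton
  refine ⟨(b + 1 - n).toNat, fun i hi x hx => ?_⟩
  obtain ⟨q, y, -, hy⟩ := hv i (by omega) x 0 (map_zero _) (by rw [hx, map_zero])
  have := hab (i + 1) (by omega)
  refine ⟨y, ?_⟩
  rw [hy, Subsingleton.elim q 0, map_zero, zero_add]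

lemma nPseudoCoherent_of_isAcyclicAtSucc {n : ℤ} {F : CochainComplex (ModuleCat.{0} R) ℤ}
    (hF : ∀ i, n ≤ i + 1 → IsAcyclicAtSucc F i) : NPseudoCoherent R n F := by
  rw [nPseudoCoherent_iff_exists_isApprox]
  refine ⟨ofModules (fun _ => PUnit) (fun _ => (0 : PUnit →ₗ[R] PUnit)) (fun _ _ => rfl), 0,
    ⟨0, 0, fun i _ => isZero_ofModules_X _ _ _ _ inferInstance⟩,
    ofModules_degreewiseFGFree _ _ _ fun _ => ⟨inferInstance, inferInstance⟩, ?_⟩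
  intro i hi x p _ hx
  obtain ⟨y, rfl⟩ := hF i hi x hx
  exact ⟨0, y, Subsingleton.elim (α := PUnit) _ _, (zero_add _).symm⟩

lemma retract_apply {F X : CochainComplex (ModuleCat.{0} R) ℤ} (s : Retract F X) (i : ℤ)
    (x : F.X i) : s.r.f i (s.i.f i x) = x := by
  rw [← ConcreteCategory.comp_apply, ← HomologicalComplex.comp_f, s.retract]
  rfl

lemma IsAcyclicAtSucc.of_retract {F X : CochainComplex (ModuleCat.{0} R) ℤ} (s : Retract F X)
    {i : ℤ} (hX : IsAcyclicAtSucc X i) : IsAcyclicAtSucc F i := by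
  intro x hx
  obtain ⟨y, hy⟩ := hX (s.i.f _ x) (by rw [← hom_d_apply, hx, map_zero])
  exact ⟨s.r.f _ y, by rw [← hom_d_apply, ← hy, retract_apply]⟩

lemma NPseudoCoherent.of_retract_of_isAcyclicAtSucc (n : ℤ) (k : ℕ) :
    ∀ {F X : CochainComplex (ModuleCat.{0} R) ℤ}, Retract F X → NPseudoCoherent R n X →
      (∀ i, n + k ≤ i + 1 → IsAcyclicAtSucc X i) → NPseudoCoherent R n F := by
  induction k with
  | zero =>
    intro F X s _ hX
    exact nPseudoCoherent_of_isAcyclicAtSucc fun i hi => (hX i (by simpa using hi)).of_retract s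
  | succ k ih =>
    intro F X s hX hacyc
    obtain ⟨N, hN⟩ : ∃ N : ℤ, N + 1 = n + k := ⟨n + k - 1, by ring⟩
    have hacyc' : ∀ i, N + 1 ≤ i → IsAcyclicAtSucc X i := fun i hi =>
      hacyc i (by push_cast; omega)
    obtain ⟨m, t, ht, hgen⟩ := hX.exists_generators (N := N) (by omega) hacyc'
    have hfam : ∀ i, ∃ (r : ℕ) (t : (Fin r → R) →ₗ[R] X.X i),
        (∀ e, X.d i (i + 1) (t e) = 0) ∧ (i ≠ N + 1 → r = 0) ∧
        ∀ j, i = j + 1 → j = N → ∀ x : X.X i, X.d i (i + 1) x = 0 →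
          ∃ (e : Fin r → R) (y : X.X j), x = t e + X.d j i y := by
      intro i
      by_cases hi : i = N + 1
      · subst hi
        refine ⟨m, t, ht, by simp, ?_⟩
        rintro j - rfl
        exact hgen
      · exact ⟨0, 0, by simp, fun _ => rfl, fun j h1 h2 => absurd (by rw [h1, h2]) hi⟩
    choose r t ht hr hgen using hfam
    let E : ℤ → Type := fun i => Fin (r i) → R
    have hE : ∀ i, (i < N + 1 ∨ N + 1 < i) → Subsingleton (E i) := by
      intro i hi
      have : r i = 0 := hr i (by omega)
      have : IsEmpty (Fin (r i)) := by rw [this]; infer_instance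
      infer_instance
    let θF : ∀ i, E i →ₗ[R] F.X i := fun i => (s.r.f i).hom ∘ₗ t i
    let θX : ∀ i, (E i × E i) →ₗ[R] X.X i := fun i =>
      LinearMap.coprod ((s.i.f i).hom ∘ₗ θF i) (t i - (s.i.f i).hom ∘ₗ θF i)
    have hθF : ∀ i e, F.d i (i + 1) (θF i e) = 0 := fun i e => by
      simp [θF, ← hom_d_apply, ht]
    have hθX : ∀ i e, X.d i (i + 1) (θX i e) = 0 := fun i e => by
      simp [θX, ← hom_d_apply, ht, hθF]
    have s' : Retract (cellCone F E θF hθF) (cellCone X (fun i => E i × E i) θX hθX) :=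
      { i := cellConeMap (fun i => LinearMap.inl R _ _) s.i fun i e => by simp [θX]
        r := cellConeMap (fun i => LinearMap.fst R _ _) s.r fun i e => by
          simp [θX, θF, retract_apply]
        retract := by
          ext i x
          obtain ⟨⟨e, x⟩, rfl⟩ := (cellConeEquiv F E θF hθF i).surjective x
          simp only [HomologicalComplex.comp_f, ModuleCat.hom_comp, LinearMap.comp_apply,
            cellConeMap_f_apply]
          exact (cellConeMap_f_apply _ _ _ _ _ _).trans
            (congrArg (fun y => cellConeEquiv F E θF hθF i (e, y)) (retract_apply s i x)) }
    refine nPseudoCoherent_of_cellCone hE θF hθF (ih s' ?_ ?_)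
    · refine nPseudoCoherent_cellCone (N := N + 1) (fun i hi => ?_) θX hθX hX
      have := hE i (by omega)
      infer_instance
    · intro i hi z hz
      obtain ⟨⟨e, x⟩, rfl⟩ := (cellConeEquiv X (fun i => E i × E i) θX hθX (i + 1)).surjective z
      have := hE (i + 1 + 1) (by omega)
      obtain rfl : e = 0 := Subsingleton.elim _ _
      have hx : X.d (i + 1) (i + 1 + 1) x = 0 := by simpa using hz
      by_cases hiN : i = N
      · obtain ⟨e, y, hy⟩ := hgen (i + 1) i rfl hiN x hx
        refine ⟨cellConeEquiv X (fun i => E i × E i) θX hθX i ((e, e), y), ?_⟩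
        rw [cellCone_d_apply, hy]
        simp [θX, add_comm]
      · obtain ⟨y, rfl⟩ := hacyc' i (by omega) x hx
        exact ⟨cellConeEquiv X (fun i => E i × E i) θX hθX i (0, y), by simp⟩

lemma NPseudoCoherent.of_retract {n : ℤ} {F X : CochainComplex (ModuleCat.{0} R) ℤ}
    (s : Retract F X) (hX : NPseudoCoherent R n X) : NPseudoCoherent R n F := by
  obtain ⟨k, hk⟩ := hX.exists_isAcyclicAtSucc
  exact of_retract_of_isAcyclicAtSucc n k s hX hk

end Retract

lemma NPseudoCoherent.biprod {R : Type} [CommRing R] {n : ℤ}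
    {F G : CochainComplex (ModuleCat.{0} R) ℤ} (hF : NPseudoCoherent R n F)
    (hG : NPseudoCoherent R n G) : NPseudoCoherent R n (F ⊞ G) := by
  rw [nPseudoCoherent_iff_exists_isApprox] at hF hG ⊢
  obtain ⟨P, f, hPb, hPf, hf⟩ := hF
  obtain ⟨Q, g, hQb, hQf, hg⟩ := hG
  let d : ∀ i, (P.X i × Q.X i) →ₗ[R] (P.X (i + 1) × Q.X (i + 1)) := fun i =>
    LinearMap.prodMap (P.d i (i + 1)).hom (Q.d i (i + 1)).hom
  have hd : ∀ i x, d (i + 1) (d i x) = 0 := fun i x => by simp [d, d_d_apply]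
  let inl : F ⟶ F ⊞ G := biprod.inl
  let inr : G ⟶ F ⊞ G := biprod.inr
  let fst : F ⊞ G ⟶ F := biprod.fst
  let snd : F ⊞ G ⟶ G := biprod.snd
  have htotal : ∀ i (x : (F ⊞ G).X i), x = inl.f i (fst.f i x) + inr.f i (snd.f i x) := by
    intro i x
    have h : fst ≫ inl + snd ≫ inr = 𝟙 (F ⊞ G) := biprod.total
    have h' := congrArg (fun u : F ⊞ G ⟶ F ⊞ G => u.f i x) h
    exact h'.symm
  have happ : ∀ {K L M : CochainComplex (ModuleCat.{0} R) ℤ} {u : K ⟶ L} {v : L ⟶ M} {w : K ⟶ M},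
      u ≫ v = w → ∀ i x, v.f i (u.f i x) = w.f i x := by
    rintro K L M u v w rfl i x
    rfl
  have h11 := happ (show inl ≫ fst = 𝟙 F from biprod.inl_fst)
  have h12 := happ (show inl ≫ snd = 0 from biprod.inl_snd)
  have h21 := happ (show inr ≫ fst = 0 from biprod.inr_fst)
  have h22 := happ (show inr ≫ snd = 𝟙 G from biprod.inr_snd)
  refine ⟨ofModules (fun i => P.X i × Q.X i) d hd, homOfLinearMaps
    (fun i => LinearMap.coprod ((inl.f i).hom ∘ₗ (f.f i).hom) ((inr.f i).hom ∘ₗ (g.f i).hom) ∘ₗ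
      (ofModulesEquiv (fun i => P.X i × Q.X i) d hd i).symm.toLinearMap) ?_, ?_, ?_, ?_⟩
  · intro i x
    obtain ⟨⟨p, q⟩, rfl⟩ := (ofModulesEquiv (fun i => P.X i × Q.X i) d hd i).surjective x
    simp [d, hom_d_apply]
  · obtain ⟨a, b, hab⟩ := hPb.subsingleton
    obtain ⟨a', b', hab'⟩ := hQb.subsingleton
    refine ⟨min a a', max b b', fun i hi => isZero_ofModules_X _ _ _ _ ?_⟩
    have := hab i (by omega)
    have := hab' i (by omega)
    infer_instance
  · refine ofModules_degreewiseFGFree _ _ _ fun i => ?_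
    have := (hPf i).1
    have := (hPf i).2
    have := (hQf i).1
    have := (hQf i).2
    exact ⟨inferInstance, inferInstance⟩
  · intro i hi x p hp hxp
    obtain ⟨⟨p, q⟩, rfl⟩ :=
      (ofModulesEquiv (fun i => P.X i × Q.X i) d hd (i + 1 + 1)).surjective p
    simp [d] at hp hxp
    obtain ⟨p', y, hp', hy⟩ := hf i hi (fst.f _ x) p hp.1 (by
      rw [← hom_d_apply, hxp, map_add, h11, h21]
      exact add_zero _)
    obtain ⟨q', z, hq', hz⟩ := hg i hi (snd.f _ x) q hp.2 (by
      rw [← hom_d_apply, hxp, map_add, h12, h22]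
      exact zero_add _)
    refine ⟨ofModulesEquiv (fun i => P.X i × Q.X i) d hd (i + 1) (p', q'),
      inl.f i y + inr.f i z, ?_, ?_⟩
    · simp [d, hp', hq']
    · rw [htotal _ x, hy, hz]
      simp [← hom_d_apply]
      abel

/-- A direct sum `F ⊕ G` of complexes in `D(A)` is `n`-pseudo-coherent if and only if both
`F` and `G` are `n`-pseudo-coherent. -/
theorem nPseudoCoherent_biprod_iff (A : Type) [CommRing A]
    (F G : CochainComplex (ModuleCat.{0} A) ℤ) (n : ℤ) :
    NPseudoCoherent A n (F ⊞ G) ↔ NPseudoCoherent A n F ∧ NPseudoCoherent A n G :=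
  ⟨fun h => ⟨h.of_retract { i := biprod.inl, r := biprod.fst },
    h.of_retract { i := biprod.inr, r := biprod.snd }⟩, fun h => h.1.biprod h.2⟩
end

section
/- Let A be a commutative ring and F a perfect complex over A. The set of primes p ∈ Spec A such that F_p has Tor-amplitude contained in [a,b] (as a complex of A_p-modules) is Zariski open in Spec A. -/
open CategoryTheory Limits MonoidalCategory HomologicalComplex

/-- Over a local ring, a complex `M₁ → M₂ → M₃` of finite modules with `M₂`, `M₃` projective which
is exact after base change to the residue field is split exact at `M₂`. -/
theorem IsLocalRing.exists_homotopy_of_exact_rTensor_residueField {R M₁ M₂ M₃ : Type*} [CommRing R]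
    [IsLocalRing R] [AddCommGroup M₁] [AddCommGroup M₂] [AddCommGroup M₃] [Module R M₁]
    [Module R M₂] [Module R M₃] [Module.Finite R M₂] [Module.Finite R M₃]
    [Module.Projective R M₂] [Module.Projective R M₃]
    (d₁ : M₁ →ₗ[R] M₂) (d₂ : M₂ →ₗ[R] M₃) (hd : d₂ ∘ₗ d₁ = 0)
    (hex : Function.Exact (d₁.rTensor (ResidueField R)) (d₂.rTensor (ResidueField R))) :
    ∃ (h₁ : M₂ →ₗ[R] M₁) (h₂ : M₃ →ₗ[R] M₂), d₁ ∘ₗ h₁ + h₂ ∘ₗ d₂ = LinearMap.id := by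
  have : Module.Free R M₃ := Module.free_of_flat_of_isLocalRing
  rw [LinearMap.rTensor_exact_iff_lTensor_exact] at hex
  let k := ResidueField R
  let π := (LinearMap.range d₁).mkQ
  have hπ : Function.Surjective π := Submodule.mkQ_surjective _
  let δ : (M₂ ⧸ LinearMap.range d₁) →ₗ[R] M₃ :=
    (LinearMap.range d₁).liftQ d₂ (LinearMap.range_le_ker_iff.mpr hd)
  have hδ : δ ∘ₗ π = d₂ := Submodule.liftQ_mkQ _ _ _
  have hinj : Function.Injective (δ.lTensor k) := by
    rw [injective_iff_map_eq_zero]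
    intro x hx
    obtain ⟨y, rfl⟩ := LinearMap.lTensor_surjective k hπ x
    rw [← LinearMap.comp_apply, ← LinearMap.lTensor_comp, hδ] at hx
    obtain ⟨z, rfl⟩ := (hex y).mp hx
    rw [← LinearMap.comp_apply, ← LinearMap.lTensor_comp, LinearMap.range_mkQ_comp,
      LinearMap.lTensor_zero, LinearMap.zero_apply]
  obtain ⟨r, hr⟩ := (IsLocalRing.split_injective_iff_lTensor_residueField_injective δ).mpr hinj
  obtain ⟨h₂, hh₂⟩ := Module.projective_lifting_property π r hπ
  have hrange : ∀ x, (LinearMap.id - h₂ ∘ₗ d₂ : M₂ →ₗ[R] M₂) x ∈ LinearMap.range d₁ := fun x ↦ by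
    rw [← Submodule.Quotient.mk_eq_zero, ← Submodule.mkQ_apply]
    have h₁ : π (h₂ (d₂ x)) = r (d₂ x) := LinearMap.congr_fun hh₂ _
    have h₂ : r (d₂ x) = π x := by
      rw [← hδ]
      exact LinearMap.congr_fun hr (π x)
    simpa [π, sub_eq_zero] using (h₁.trans h₂).symm
  obtain ⟨h₁, hh₁⟩ := Module.projective_lifting_property d₁.rangeRestrict
    ((LinearMap.id - h₂ ∘ₗ d₂ : M₂ →ₗ[R] M₂).codRestrict _ hrange) d₁.surjective_rangeRestrict
  refine ⟨h₁, h₂, ?_⟩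
  ext x
  have := congr_arg Subtype.val (LinearMap.congr_fun hh₁ x)
  simp at this
  simp [this]

/-- A splitting of the localization of a complex `M₁ → M₂ → M₃` of finite projective modules
descends, up to a denominator. -/
theorem IsLocalizedModule.exists_homotopy {R M₁ M₂ M₃ N₁ N₂ N₃ : Type*} [CommRing R]
    (S : Submonoid R) [AddCommGroup M₁] [AddCommGroup M₂] [AddCommGroup M₃] [Module R M₁]
    [Module R M₂] [Module R M₃] [Module.FinitePresentation R M₂] [Module.FinitePresentation R M₃]
    [AddCommGroup N₁] [AddCommGroup N₂] [AddCommGroup N₃] [Module R N₁]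
    [Module R N₂] [Module R N₃] (f₁ : M₁ →ₗ[R] N₁) (f₂ : M₂ →ₗ[R] N₂) (f₃ : M₃ →ₗ[R] N₃)
    [IsLocalizedModule S f₁] [IsLocalizedModule S f₂]
    (d₁ : M₁ →ₗ[R] M₂) (d₂ : M₂ →ₗ[R] M₃) (e₁ : N₁ →ₗ[R] N₂) (e₂ : N₂ →ₗ[R] N₃)
    (h₁ : N₂ →ₗ[R] N₁) (h₂ : N₃ →ₗ[R] N₂)
    (comm₁ : ∀ x, e₁ (f₁ x) = f₂ (d₁ x)) (comm₂ : ∀ x, e₂ (f₂ x) = f₃ (d₂ x))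
    (hh : ∀ x, e₁ (h₁ x) + h₂ (e₂ x) = x) :
    ∃ s ∈ S, ∃ (k₁ : M₂ →ₗ[R] M₁) (k₂ : M₃ →ₗ[R] M₂),
      d₁ ∘ₗ k₁ + k₂ ∘ₗ d₂ = s • LinearMap.id := by
  obtain ⟨k₁, s₁, hk₁⟩ :=
    Module.FinitePresentation.exists_lift_of_isLocalizedModule S f₁ (h₁ ∘ₗ f₂)
  obtain ⟨k₂, s₂, hk₂⟩ :=
    Module.FinitePresentation.exists_lift_of_isLocalizedModule S f₂ (h₂ ∘ₗ f₃)
  have hk₁ (x) : f₁ (k₁ x) = (s₁ : R) • h₁ (f₂ x) := LinearMap.congr_fun hk₁ x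
  have hk₂ (x) : f₂ (k₂ x) = (s₂ : R) • h₂ (f₃ x) := LinearMap.congr_fun hk₂ x
  obtain ⟨t, ht⟩ := Module.Finite.exists_smul_of_comp_eq_of_isLocalizedModule S f₂
    (d₁ ∘ₗ ((s₂ : R) • k₁) + ((s₁ : R) • k₂) ∘ₗ d₂) (((s₁ : R) * s₂) • LinearMap.id) <| by
      ext x
      simp only [LinearMap.comp_apply, LinearMap.add_apply, LinearMap.smul_apply, map_add,
        map_smul, LinearMap.id_apply, ← comm₁, hk₁, hk₂, ← comm₂]
      conv_rhs => rw [← hh (f₂ x)]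
      module
  refine ⟨t * (s₁ * s₂), (t * (s₁ * s₂)).2, (t : R) • (s₂ : R) • k₁, (t : R) • (s₁ : R) • k₂, ?_⟩
  ext x
  have := LinearMap.congr_fun ht x
  simp only [Submonoid.smul_def, LinearMap.smul_apply, LinearMap.add_apply, LinearMap.comp_apply,
    map_smul, LinearMap.id_apply, smul_add, mul_smul] at this ⊢
  exact this

/-- The scalar `s` is null-homotopic on the degree `i` term of the complex `F`. -/
def IsNullHomotopicAt {R : Type} [CommRing R] (F : CochainComplex (ModuleCat.{0} R) ℤ) (i : ℤ)
    (s : R) : Prop :=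
  ∃ (h₁ : F.X i ⟶ F.X (i - 1)) (h₂ : F.X (i + 1) ⟶ F.X i),
    h₁ ≫ F.d (i - 1) i + F.d i (i + 1) ≫ h₂ = s • 𝟙 (F.X i)

section

open scoped TensorProduct

variable {R : Type} [CommRing R] {F : CochainComplex (ModuleCat.{0} R) ℤ} {i : ℤ}

theorem isZero_homology_iff_exact (F : CochainComplex (ModuleCat.{0} R) ℤ) (i : ℤ) :
    IsZero (F.homology i) ↔
      Function.Exact (F.d (i - 1) i).hom (F.d i (i + 1)).hom := by
  rw [← exactAt_iff_isZero_homology, F.exactAt_iff' (i - 1) i (i + 1) (by simp) (by simp)]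
  exact ShortComplex.ShortExact.moduleCat_exact_iff_function_exact _

theorem IsNullHomotopicAt.isZero_homology {s : R} (hs : IsUnit s) (h : IsNullHomotopicAt F i s) :
    IsZero (F.homology i) := by
  obtain ⟨h₁, h₂, h⟩ := h
  obtain ⟨u, rfl⟩ := hs
  rw [isZero_homology_iff_exact]
  intro x
  refine ⟨fun hx ↦ ⟨(↑u⁻¹ : R) • h₁.hom x, ?_⟩, ?_⟩
  · have := LinearMap.congr_fun (congr_arg ModuleCat.Hom.hom h) x
    simp [hx] at this
    simp [this, smul_smul]
  · rintro ⟨y, rfl⟩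
    exact LinearMap.congr_fun (congr_arg ModuleCat.Hom.hom (F.d_comp_d (i - 1) i (i + 1))) y

theorem IsNullHomotopicAt.tensorComplex {s : R} (h : IsNullHomotopicAt F i s)
    (K : ModuleCat.{0} R) :
    IsNullHomotopicAt (tensorComplex R F K) i s := by
  obtain ⟨h₁, h₂, h⟩ := h
  refine ⟨h₁ ▷ K, h₂ ▷ K, ?_⟩
  have := congr_arg (· ▷ K) h
  simp only [MonoidalPreadditive.add_whiskerRight, comp_whiskerRight,
    MonoidalLinear.smul_whiskerRight, id_whiskerRight] at this
  exact this

theorem IsNullHomotopicAt.extendScalars {S : Type} [CommRing S] (f : R →+* S) {s : R}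
    (h : IsNullHomotopicAt F i s) :
    IsNullHomotopicAt (((ModuleCat.extendScalars f).mapHomologicalComplex _).obj F) i (f s) := by
  obtain ⟨h₁, h₂, h⟩ := h
  refine ⟨(ModuleCat.extendScalars f).map h₁, (ModuleCat.extendScalars f).map h₂, ?_⟩
  have : (ModuleCat.extendScalars f).Additive :=
    (ModuleCat.extendRestrictScalarsAdj f).left_adjoint_additive
  have := congr_arg (ModuleCat.extendScalars f).map h
  rw [Functor.map_add, Functor.map_comp, Functor.map_comp] at this
  refine this.trans ?_
  apply ModuleCat.ExtendScalars.hom_ext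
  intro x
  let := f.toAlgebra
  change (1 : S) ⊗ₜ[R] (s • x) = (f s * 1) ⊗ₜ[R] x
  rw [← TensorProduct.smul_tmul, Algebra.smul_def]
  rfl

end

/-- If the localization of `F` at `p` is universally exact in degree `i`, then some scalar outside
of `p` is null-homotopic on `F` in degree `i`. -/
theorem exists_isNullHomotopicAt {A : Type} [CommRing A]
    (F : CochainComplex (ModuleCat.{0} A) ℤ) (hF : DegreewiseFGProj A F) (i : ℤ)
    (p : Ideal A) [p.IsPrime] {S : Type} [CommRing S] (f : A →+* S)
    (hf : letI := f.toAlgebra; IsLocalization.AtPrime S p)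
    (hK : ∀ K, IsZero ((tensorComplex S
      (((ModuleCat.extendScalars f).mapHomologicalComplex _).obj F) K).homology i)) :
    ∃ s ∉ p, IsNullHomotopicAt F i s := by
  let := f.toAlgebra
  have : IsLocalRing S := IsLocalization.AtPrime.isLocalRing S p
  have _ (j) : Module.Finite A (F.X j) := (hF j).1
  have _ (j) : Module.Projective A (F.X j) := (hF j).2
  have _ (j) : Module.FinitePresentation A (F.X j) := Module.finitePresentation_of_projective A _
  let G := ((ModuleCat.extendScalars f).mapHomologicalComplex (ComplexShape.up ℤ)).obj F
  have _ (j) : Module.Finite S (G.X j) :=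
    inferInstanceAs (Module.Finite S (TensorProduct A S (F.X j)))
  have _ (j) : Module.Projective S (G.X j) :=
    inferInstanceAs (Module.Projective S (TensorProduct A S (F.X j)))
  have hex := (isZero_homology_iff_exact _ _).mp (hK (ModuleCat.of S (IsLocalRing.ResidueField S)))
  obtain ⟨h₁, h₂, hh⟩ := IsLocalRing.exists_homotopy_of_exact_rTensor_residueField
    (G.d (i - 1) i).hom (G.d i (i + 1)).hom
    (congr_arg ModuleCat.Hom.hom (G.d_comp_d (i - 1) i (i + 1))) hex
  let e (j k : ℤ) : TensorProduct A S (F.X j) →ₗ[S] TensorProduct A S (F.X k) := (G.d j k).hom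
  let g₁ : TensorProduct A S (F.X i) →ₗ[S] TensorProduct A S (F.X (i - 1)) := h₁
  let g₂ : TensorProduct A S (F.X (i + 1)) →ₗ[S] TensorProduct A S (F.X i) := h₂
  obtain ⟨s, hs, k₁, k₂, hk⟩ := IsLocalizedModule.exists_homotopy p.primeCompl
    (TensorProduct.mk A S (F.X (i - 1)) 1) (TensorProduct.mk A S (F.X i) 1)
    (TensorProduct.mk A S (F.X (i + 1)) 1) (F.d (i - 1) i).hom (F.d i (i + 1)).hom
    ((e (i - 1) i).restrictScalars A) ((e i (i + 1)).restrictScalars A)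
    (g₁.restrictScalars A) (g₂.restrictScalars A)
    (fun x ↦ rfl) (fun x ↦ rfl) (fun x ↦ LinearMap.congr_fun hh x)
  exact ⟨s, hs, ModuleCat.ofHom k₁, ModuleCat.ofHom k₂, ModuleCat.hom_ext hk⟩

/-- For a perfect complex `F` over a commutative ring `A`, the set of primes `p` such that
the localization `F_p` has Tor-amplitude contained in `[a,b]` over `A_p` is Zariski open
in `Spec A`. -/
theorem isOpen_torAmp_locus (A : Type) [CommRing A]
    (F : CochainComplex (ModuleCat.{0} A) ℤ) (hF : IsPerfectData A F) (a b : ℤ) :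
    IsOpen {p : PrimeSpectrum A |
      TorAmpPlain (Localization.AtPrime p.asIdeal)
        (((ModuleCat.extendScalars
          (algebraMap A (Localization.AtPrime p.asIdeal))).mapHomologicalComplex _).obj F)
        a b} := by
  obtain ⟨⟨m, N, hmN⟩, hproj⟩ := hF
  have key : {p : PrimeSpectrum A |
      TorAmpPlain (Localization.AtPrime p.asIdeal)
        (((ModuleCat.extendScalars
          (algebraMap A (Localization.AtPrime p.asIdeal))).mapHomologicalComplex _).obj F)
        a b} = ⋂ i ∈ {i ∈ Set.Icc m N | i < a ∨ b < i},
          ⋃ s ∈ {s | IsNullHomotopicAt F i s}, (PrimeSpectrum.basicOpen s : Set _) := by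
    ext p
    simp only [Set.mem_ofPred_eq, Set.mem_iInter, Set.mem_iUnion, exists_prop]
    constructor
    · intro h i hi
      have hloc : letI := (algebraMap A (Localization.AtPrime p.asIdeal)).toAlgebra
          IsLocalization.AtPrime (Localization.AtPrime p.asIdeal) p.asIdeal := by
        convert Localization.isLocalization (M := p.asIdeal.primeCompl)
        exact Algebra.algebra_ext _ _ fun _ ↦ rfl
      obtain ⟨s, hs, h⟩ := exists_isNullHomotopicAt F hproj i p.asIdeal _ hloc
        fun K ↦ h K i hi.2
      exact ⟨s, h, hs⟩
    · intro h K i hi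
      obtain ⟨s, hs, hnull⟩ : ∃ s ∉ p.asIdeal, IsNullHomotopicAt F i s := by
        by_cases him : i ∈ Set.Icc m N
        · obtain ⟨s, h, hs⟩ := h i ⟨him, hi⟩
          exact ⟨s, hs, h⟩
        · have hz := hmN i (by rw [Set.mem_Icc] at him; omega)
          exact ⟨1, p.asIdeal.ne_top_iff_one.mp p.2.ne_top, 0, 0, hz.eq_of_src _ _⟩
      exact ((hnull.extendScalars _).tensorComplex K).isZero_homology
        (IsLocalization.map_units _ (⟨s, hs⟩ : p.asIdeal.primeCompl))
  rw [key]
  exact ((Set.finite_Icc m N).subset (Set.sep_subset _ _)).isOpen_biInter fun i _ ↦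
    isOpen_biUnion fun s _ ↦ (PrimeSpectrum.basicOpen s).isOpen
end
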